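/- Let τ > √6 and let ρ_min be a minimizing measure with support M. Then M is totally disconnected and the Hausdorff dimension of M is at most 6/7. -/

import Mathlib

open MeasureTheory Set
open scoped RealInnerProductSpace ENNReal

noncomputable section

/-- Euclidean three-space. -/
abbrev E3 := EuclideanSpace ℝ (Fin 3)

/-- The unit sphere `S² ⊂ ℝ³`. -/
def Sphere2 : Set E3 := Metric.sphere 0 1

/-- The function `D(x,y) = (1/4)(1+⟨x,y⟩)(2 − τ²(1−⟨x,y⟩))`. -/
def Dfun (τ : ℝ) (x y : E3) : ℝ :=
  (1 / 4) * (1 + ⟪x, y⟫) * (2 - τ ^ 2 * (1 - ⟪x, y⟫))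

/-- The Lagrangian `L = max(0, D)`. -/
def Lfun (τ : ℝ) (x y : E3) : ℝ := max 0 (Dfun τ x y)

/-- The causal action of a measure. -/
def causalAction (τ : ℝ) (ρ : Measure E3) : ℝ :=
  ∫ x, ∫ y, Lfun τ x y ∂ρ ∂ρ

/-- `ρ` is a minimizing measure: a regular Borel probability measure supported on `S²`
minimizing the causal action among all such measures. -/
def IsMinimizer (τ : ℝ) (ρ : Measure E3) : Prop :=
  IsProbabilityMeasure ρ ∧ ρ.Regular ∧ ρ Sphere2ᶜ = 0 ∧
    ∀ ρ' : Measure E3, IsProbabilityMeasure ρ' → ρ'.Regular → ρ' Sphere2ᶜ = 0 →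
      causalAction τ ρ ≤ causalAction τ ρ'

/-- The support of a measure. -/
def msupport (ρ : Measure E3) : Set E3 :=
  {x | ∀ U : Set E3, IsOpen U → x ∈ U → 0 < ρ U}

/-- The opening angle `θ_max = arccos(1 − 2/τ²)`. -/
def θmax (τ : ℝ) : ℝ := Real.arccos (1 - 2 / τ ^ 2)

/-- The open light cone `I(p)`. -/
def lightConeI (τ : ℝ) (p : E3) : Set E3 := {q ∈ Sphere2 | 0 < Dfun τ p q}

/-- The boundary of the light cone `K(p)`. -/
def lightConeK (τ : ℝ) (p : E3) : Set E3 :=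
  {q ∈ Sphere2 | ⟪p, q⟫ = Real.cos (θmax τ)}

/-- Make a point of `ℝ³` from coordinates. -/
def mkE3 (a b c : ℝ) : E3 := (WithLp.equiv 2 (Fin 3 → ℝ)).symm ![a, b, c]

/-- A totally timelike set. -/
def TotallyTimelike (τ : ℝ) (Ω : Set E3) : Prop := ∀ x ∈ Ω, ∀ y ∈ Ω, 0 < Dfun τ x y

/-- `p` is an accumulation point of `A`: every neighborhood of `p` contains a point
of `A` different from `p`. -/
def AccumulationPt (p : E3) (A : Set E3) : Prop :=
  ∀ U ∈ nhds p, ∃ x ∈ A, x ∈ U ∧ x ≠ p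

/-- `γ(0)` is a uniform two-sided accumulation point (of points of `M`) on `γ` of
scaling `β`, where `γ` is defined on `(−δ, δ)`. -/
def UniformTwoSidedAcc (M : Set E3) (β δ : ℝ) (γ : ℝ → E3) : Prop :=
  ∃ ε₀ : ℝ, 0 < ε₀ ∧ ε₀ < δ ∧ ∀ ε : ℝ, 0 < ε → ε ≤ ε₀ →
    (∃ t ∈ Set.Ioo (-ε) (-(ε ^ (1 + β))), γ t ∈ M) ∧
    (∃ t ∈ Set.Ioo (ε ^ (1 + β)) ε, γ t ∈ M)

/-- The point `q₁ = (cos θ_max, 0, sin θ_max)`. -/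
def q1pt (τ : ℝ) : E3 := mkE3 (Real.cos (θmax τ)) 0 (Real.sin (θmax τ))

/-- The point `q₂ = (cos θ_max, 0, −sin θ_max)`. -/
def q2pt (τ : ℝ) : E3 := mkE3 (Real.cos (θmax τ)) 0 (-Real.sin (θmax τ))

/-- The curve `p_s = (cos s, sin s, 0)` along the equator. -/
def pcurve (s : ℝ) : E3 := mkE3 (Real.cos s) (Real.sin s) 0

/-- Geodesic ball in `S²` of radius `r` around `q`. -/
def geoBall (q : E3) (r : ℝ) : Set E3 := {x ∈ Sphere2 | Real.arccos ⟪q, x⟫ < r}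

/-- The set `U_r = (B_r(q₁) ∪ B_r(q₂)) ∖ {q₁, q₂}`. -/
def Uset (τ r : ℝ) : Set E3 := (geoBall (q1pt τ) r ∪ geoBall (q2pt τ) r) \ {q1pt τ, q2pt τ}

/-- The set `I_r(q) = I(q) ∖ U_r`. -/
def Iset (τ r : ℝ) (q : E3) : Set E3 := lightConeI τ q \ Uset τ r

/-- The point of `S²` with latitude `θ` (measured from the equator) and longitude `φ`. -/
def sphPt (θ φ : ℝ) : E3 :=
  mkE3 (Real.cos θ * Real.cos φ) (Real.cos θ * Real.sin φ) (Real.sin θ)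

/-- The restrictions to `Ω` of polynomials of degree at most two on `ℝ³`. -/
def polyRestrictSet (Ω : Set E3) : Set (Ω → ℝ) :=
  {f | ∃ P : MvPolynomial (Fin 3) ℝ, P.totalDegree ≤ 2 ∧
        ∀ x : Ω, f x = MvPolynomial.eval (fun i => (x : E3) i) P}

/-- The space `K(Ω)` of restrictions to `Ω` of polynomials of degree at most two. -/
def KSpace (Ω : Set E3) : Submodule ℝ (Ω → ℝ) := Submodule.span ℝ (polyRestrictSet Ω)

/-- Two-dimensional Hausdorff (surface) measure on `S²` restricted to `Ω`, as a
measure on `Ω`. -/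
def surfΩ (Ω : Set E3) : Measure Ω := Measure.comap Subtype.val (μH[2] : Measure E3)

/-- The bilinear form `B(f,g) = ∫_Ω ∫_Ω D(x,y) f(x) g(y) dμ(x) dμ(y)` on functions on `Ω`. -/
def Bform (τ : ℝ) (Ω : Set E3) (f g : Ω → ℝ) : ℝ :=
  ∫ x, ∫ y, Dfun τ (x : E3) (y : E3) * f x * g y ∂(surfΩ Ω) ∂(surfΩ Ω)

end

lemma continuous_Dfun (τ : ℝ) : Continuous (fun z : E3 × E3 => Dfun τ z.1 z.2) := by
  unfold Dfun; fun_prop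

lemma continuous_Lfun (τ : ℝ) : Continuous (fun z : E3 × E3 => Lfun τ z.1 z.2) := by
  unfold Lfun; exact continuous_const.max (continuous_Dfun τ)

lemma Lfun_symm (τ : ℝ) (x y : E3) : Lfun τ x y = Lfun τ y x := by
  unfold Lfun Dfun; rw [real_inner_comm]

lemma continuous_Lfun_right (τ : ℝ) (x : E3) : Continuous (fun y => Lfun τ x y) :=
  (continuous_Lfun τ).comp (Continuous.prodMk_right x)

lemma isCompact_Sphere2 : IsCompact Sphere2 := isCompact_sphere _ _

lemma restrict_Sphere2 (μ : Measure E3) (h : μ Sphere2ᶜ = 0) : μ.restrict Sphere2 = μ :=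
  Measure.restrict_eq_self_of_ae_mem (by simpa [mem_ae_iff] using h)

lemma intg_of_cont (μ : Measure E3) [IsFiniteMeasure μ] (h : μ Sphere2ᶜ = 0)
    {f : E3 → ℝ} (hf : Continuous f) : Integrable f μ := by
  have := hf.continuousOn.integrableOn_compact (μ := μ) isCompact_Sphere2
  rwa [IntegrableOn, restrict_Sphere2 μ h] at this

lemma intg_prod_of_cont (μ ν : Measure E3) [IsFiniteMeasure μ] [IsFiniteMeasure ν]
    (h : μ Sphere2ᶜ = 0) (h' : ν Sphere2ᶜ = 0)
    {f : E3 × E3 → ℝ} (hf : Continuous f) : Integrable f (μ.prod ν) := by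
  have := hf.continuousOn.integrableOn_compact (μ := μ.prod ν)
    (isCompact_Sphere2.prod isCompact_Sphere2)
  rwa [IntegrableOn, ← Measure.prod_restrict, restrict_Sphere2 μ h, restrict_Sphere2 ν h'] at this

noncomputable def ell (τ : ℝ) (ρ : Measure E3) (x : E3) : ℝ := ∫ y, Lfun τ x y ∂ρ

lemma continuous_ell (τ : ℝ) (ρ : Measure E3) [IsFiniteMeasure ρ] (h : ρ Sphere2ᶜ = 0) :
    Continuous (ell τ ρ) := by
  have := continuous_parametric_integral_of_continuous (μ := ρ) (f := fun x y => Lfun τ x y)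
    (continuous_Lfun τ) isCompact_Sphere2
  rw [restrict_Sphere2 ρ h] at this
  exact this

lemma ell_ge (τ : ℝ) (ρ : Measure E3) (hm : IsMinimizer τ ρ) (y : E3) (hy : y ∈ Sphere2) :
    causalAction τ ρ ≤ ell τ ρ y := by
  obtain ⟨hp, hr, h0, hmin⟩ := hm
  set S := causalAction τ ρ with hS
  have hd0 : (Measure.dirac y) Sphere2ᶜ = 0 := by
    rw [Measure.dirac_apply' _ isCompact_Sphere2.measurableSet.compl]
    simp [hy]
  have key : ∀ ε : ℝ, 0 < ε → ε < 1 →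
      2 * (S - ell τ ρ y) ≤ ε * (S - 2 * ell τ ρ y + Lfun τ y y) := by
    intro ε e0 e1
    set ρ' : Measure E3 := ENNReal.ofReal (1 - ε) • ρ + ENNReal.ofReal ε • Measure.dirac y
      with hρ'
    have hint : ∀ f : E3 → ℝ, Continuous f → ∫ x, f x ∂ρ' = (1 - ε) * ∫ x, f x ∂ρ + ε * f y := by
      intro f hf
      rw [hρ', integral_add_measure, integral_smul_measure, integral_smul_measure,
        integral_dirac, ENNReal.toReal_ofReal (by linarith), ENNReal.toReal_ofReal e0.le]
      · rfl
      · exact (intg_of_cont ρ h0 hf).smul_measure ENNReal.ofReal_ne_top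
      · exact (intg_of_cont _ hd0 hf).smul_measure ENNReal.ofReal_ne_top
    have hprob : IsProbabilityMeasure ρ' := by
      constructor
      simp only [hρ', Measure.add_apply, Measure.smul_apply, measure_univ, smul_eq_mul, mul_one]
      rw [← ENNReal.ofReal_add (by linarith) e0.le]; simp
    have h1 := hmin ρ' hprob inferInstance (by simp [hρ', h0, hd0])
    have h2 : causalAction τ ρ' = (1 - ε) * ((1 - ε) * S + ε * ell τ ρ y)
        + ε * ((1 - ε) * ell τ ρ y + ε * Lfun τ y y) := by
      unfold causalAction
      have : ∀ x, ∫ z, Lfun τ x z ∂ρ' = (1 - ε) * ell τ ρ x + ε * Lfun τ x y := fun x =>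
        hint _ (continuous_Lfun_right τ x)
      simp_rw [this]
      have hc : Continuous (fun x => Lfun τ x y) := by
        simp_rw [fun x => Lfun_symm τ x y]; exact continuous_Lfun_right τ y
      rw [hint (fun x => (1 - ε) * ell τ ρ x + ε * Lfun τ x y)
        (((continuous_ell τ ρ h0).const_mul _).add (hc.const_mul _))]
      rw [integral_add ((intg_of_cont ρ h0 (continuous_ell τ ρ h0)).const_mul _)
        ((intg_of_cont ρ h0 hc).const_mul _), integral_const_mul, integral_const_mul]
      have : ∫ a, Lfun τ a y ∂ρ = ell τ ρ y := by
        unfold ell; simp_rw [fun x => Lfun_symm τ x y]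
      rw [this]; rfl
    rw [h2] at h1
    have : 0 ≤ ε * (-2 * (S - ell τ ρ y) + ε * (S - 2 * ell τ ρ y + Lfun τ y y)) := by
      nlinarith
    have := nonneg_of_mul_nonneg_right this e0
    linarith
  by_contra hlt
  push Not at hlt
  set c := S - 2 * ell τ ρ y + Lfun τ y y
  set d := S - ell τ ρ y with hd
  have hd : 0 < d := by rw [hd]; linarith
  have h3 := key (min (1/2) (d / (|c| + 1))) (by positivity) (by
    refine lt_of_le_of_lt (min_le_left _ _) (by norm_num))
  have h4 : min (1/2) (d / (|c| + 1)) * c ≤ d / (|c| + 1) * (|c| + 1) := by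
    calc min (1/2) (d / (|c| + 1)) * c ≤ min (1/2) (d / (|c| + 1)) * (|c| + 1) := by
          apply mul_le_mul_of_nonneg_left (by linarith [le_abs_self c]) (by positivity)
      _ ≤ _ := mul_le_mul_of_nonneg_right (min_le_right _ _) (by positivity)
  rw [div_mul_cancel₀ _ (by positivity)] at h4
  linarith

lemma msupport_sub (ρ : Measure E3) (h0 : ρ Sphere2ᶜ = 0) : msupport ρ ⊆ Sphere2 := by
  intro x hx
  by_contra hn
  have := hx Sphere2ᶜ isCompact_Sphere2.isClosed.isOpen_compl hn
  simp [h0] at this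

lemma ell_ae (τ : ℝ) (ρ : Measure E3) (hm : IsMinimizer τ ρ) :
    ∀ᵐ x ∂ρ, ell τ ρ x = causalAction τ ρ := by
  have hge := ell_ge τ ρ hm
  obtain ⟨hp, hr, h0, hmin⟩ := hm
  have hS : ∀ᵐ x ∂ρ, x ∈ Sphere2 := h0
  have hi := intg_of_cont ρ h0 (continuous_ell τ ρ h0)
  have hnn : 0 ≤ᵐ[ρ] fun x => ell τ ρ x - causalAction τ ρ := by
    filter_upwards [hS] with x hx
    have := hge x hx
    simp; linarith
  have hz : ∫ x, (ell τ ρ x - causalAction τ ρ) ∂ρ = 0 := by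
    rw [integral_sub hi (integrable_const _)]
    simp only [integral_const, probReal_univ, one_smul]
    exact sub_self _
  have := (integral_eq_zero_iff_of_nonneg_ae hnn (hi.sub (integrable_const _))).1 hz
  filter_upwards [this] with x hx
  simp at hx; linarith

lemma ell_eq (τ : ℝ) (ρ : Measure E3) (hm : IsMinimizer τ ρ) (x : E3) (hx : x ∈ msupport ρ) :
    ell τ ρ x = causalAction τ ρ := by
  have hae := ell_ae τ ρ hm
  obtain ⟨hp, hr, h0, hmin⟩ := hm
  by_contra hne
  have hU : IsOpen {z | ell τ ρ z ≠ causalAction τ ρ} :=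
    isOpen_ne_fun (continuous_ell τ ρ h0) continuous_const
  have := hx _ hU hne
  rw [ae_iff] at hae
  exact this.ne' hae

lemma quad_nonneg0 (τ : ℝ) (ρ : Measure E3) (hm : IsMinimizer τ ρ) (f : E3 → ℝ)
    (hf : Measurable f) (C : ℝ) (hC : 0 < C) (hb : ∀ x, |f x| ≤ C) (hz : ∫ x, f x ∂ρ = 0) :
    0 ≤ ∫ x, (∫ y, Lfun τ x y * f y ∂ρ) * f x ∂ρ := by
  have hae := ell_ae τ ρ hm
  obtain ⟨hp, hr, h0, hmin⟩ := hm
  set S := causalAction τ ρ with hS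
  have hfi : Integrable f ρ := by
    refine Integrable.of_bound hf.aestronglyMeasurable C (Filter.Eventually.of_forall hb)
  have hLi : Integrable (fun z : E3 × E3 => Lfun τ z.1 z.2) (ρ.prod ρ) :=
    intg_prod_of_cont ρ ρ h0 h0 (continuous_Lfun τ)
  have hLf : Integrable (fun z : E3 × E3 => Lfun τ z.1 z.2 * f z.2) (ρ.prod ρ) :=
    hLi.mul_bdd (c := C) (hf.comp measurable_snd).aestronglyMeasurable
      (Filter.Eventually.of_forall fun z => hb z.2)
  have hLx : ∀ x, Integrable (fun y => Lfun τ x y) ρ := fun x =>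
    intg_of_cont ρ h0 (continuous_Lfun_right τ x)
  have hLfx : ∀ x, Integrable (fun y => Lfun τ x y * f y) ρ := fun x =>
    (hLx x).mul_bdd (c := C) hf.aestronglyMeasurable (Filter.Eventually.of_forall hb)
  set G : E3 → ℝ := fun x => ∫ y, Lfun τ x y * f y ∂ρ with hG
  have hGi : Integrable G ρ := hLf.integral_prod_left
  have hell := intg_of_cont ρ h0 (continuous_ell τ ρ h0)
  have hmulf : ∀ g : E3 → ℝ, Integrable g ρ → Integrable (fun x => g x * f x) ρ := fun g hg =>
    hg.mul_bdd (c := C) hf.aestronglyMeasurable (Filter.Eventually.of_forall hb)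
  have e1 : ∫ x, ell τ ρ x * f x ∂ρ = 0 := by
    have : ∫ x, ell τ ρ x * f x ∂ρ = ∫ x, S * f x ∂ρ := by
      apply integral_congr_ae
      filter_upwards [hae] with x hx
      rw [hx]
    rw [this, integral_const_mul, hz, mul_zero]
  have e2 : ∫ x, G x ∂ρ = 0 := by
    rw [← e1]
    simp only [hG]
    rw [integral_integral_swap (f := fun x y => Lfun τ x y * f y) hLf]
    apply integral_congr_ae
    refine Filter.Eventually.of_forall fun y => ?_
    simp only [integral_mul_const, ell]
    congr 1
    simp_rw [fun x => Lfun_symm τ x y]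
  set ε := 1 / C with hε
  have hεp : 0 < ε := by positivity
  have hpos : ∀ x, 0 ≤ 1 + ε * f x := by
    intro x
    have h1 := (abs_le.1 (hb x)).1
    have : ε * (-C) ≤ ε * f x := mul_le_mul_of_nonneg_left h1 hεp.le
    have h2 : ε * C = 1 := by rw [hε]; field_simp
    linarith
  set ρ' : Measure E3 := ρ.withDensity (fun x => ((Real.toNNReal (1 + ε * f x) : NNReal) : ℝ≥0∞))
    with hρ'
  have hint : ∀ g : E3 → ℝ, Integrable g ρ →
      ∫ x, g x ∂ρ' = ∫ x, g x ∂ρ + ε * ∫ x, g x * f x ∂ρ := by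
    intro g hg
    rw [hρ', integral_withDensity_eq_integral_smul (by fun_prop)]
    rw [← integral_const_mul, ← integral_add hg ((hmulf g hg).const_mul _)]
    apply integral_congr_ae
    refine Filter.Eventually.of_forall fun x => ?_
    simp only [NNReal.smul_def, smul_eq_mul, Real.coe_toNNReal _ (hpos x)]
    ring
  have hprob : IsProbabilityMeasure ρ' := by
    constructor
    rw [hρ', withDensity_apply _ MeasurableSet.univ, Measure.restrict_univ]
    have := ofReal_integral_eq_lintegral_ofReal (f := fun x => 1 + ε * f x) (μ := ρ)
      ((integrable_const _).add (hfi.const_mul _)) (Filter.Eventually.of_forall hpos)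
    simp only [ENNReal.ofReal] at this
    rw [← this, integral_add (integrable_const _) (hfi.const_mul _), integral_const_mul, hz]
    simp
  have hac : ρ' Sphere2ᶜ = 0 := withDensity_absolutelyContinuous _ _ h0
  have h1 := hmin ρ' hprob inferInstance hac
  have h2 : causalAction τ ρ' = S + ε ^ 2 * ∫ x, G x * f x ∂ρ := by
    unfold causalAction
    have : ∀ x, ∫ z, Lfun τ x z ∂ρ' = ell τ ρ x + ε * G x := fun x => hint _ (hLx x)
    simp_rw [this]
    rw [hint (fun x => ell τ ρ x + ε * G x) (hell.add (hGi.const_mul _))]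
    rw [integral_add hell (hGi.const_mul _), integral_const_mul, e2]
    have : ∫ x, (ell τ ρ x + ε * G x) * f x ∂ρ = ε * ∫ x, G x * f x ∂ρ := by
      rw [← integral_const_mul]
      have : ∀ x, (ell τ ρ x + ε * G x) * f x = ell τ ρ x * f x + ε * (G x * f x) := by
        intro x; ring
      simp_rw [this]
      rw [integral_add (hmulf _ hell) ((hmulf _ hGi).const_mul _), e1, zero_add]
    rw [this]
    have : ∫ x, ell τ ρ x ∂ρ = S := rfl
    rw [this]; ring
  rw [h2] at h1
  have : 0 ≤ ε ^ 2 * ∫ x, G x * f x ∂ρ := by linarith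
  exact nonneg_of_mul_nonneg_right this (by positivity)

lemma quad_nonneg (τ : ℝ) (ρ : Measure E3) (hm : IsMinimizer τ ρ) (f : E3 → ℝ)
    (hf : Measurable f) (C : ℝ) (hC : 0 < C) (hb : ∀ x, |f x| ≤ C) :
    0 ≤ ∫ x, (∫ y, Lfun τ x y * f y ∂ρ) * f x ∂ρ := by
  have hae := ell_ae τ ρ hm
  have hm' := hm
  obtain ⟨hp, hr, h0, hmin⟩ := hm
  set S := causalAction τ ρ with hS
  have hfi : Integrable f ρ := by
    refine Integrable.of_bound hf.aestronglyMeasurable C (Filter.Eventually.of_forall hb)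
  set m := ∫ x, f x ∂ρ with hmm
  have hz : ∫ x, (f x - m) ∂ρ = 0 := by
    rw [integral_sub hfi (integrable_const _)]; simp [hmm]
  have hb' : ∀ x, |f x - m| ≤ C + |m| := fun x =>
    (abs_sub _ _).trans (by linarith [hb x])
  have hf' : Measurable (fun x => f x - m) := hf.sub_const m
  have key := quad_nonneg0 τ ρ hm' (fun x => f x - m) hf' (C + |m|) (by positivity) hb' hz
  have hLi : Integrable (fun z : E3 × E3 => Lfun τ z.1 z.2) (ρ.prod ρ) :=
    intg_prod_of_cont ρ ρ h0 h0 (continuous_Lfun τ)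
  have hLf : Integrable (fun z : E3 × E3 => Lfun τ z.1 z.2 * f z.2) (ρ.prod ρ) :=
    hLi.mul_bdd (c := C) (hf.comp measurable_snd).aestronglyMeasurable
      (Filter.Eventually.of_forall fun z => hb z.2)
  have hLx : ∀ x, Integrable (fun y => Lfun τ x y) ρ := fun x =>
    intg_of_cont ρ h0 (continuous_Lfun_right τ x)
  have hLfx : ∀ x, Integrable (fun y => Lfun τ x y * f y) ρ := fun x =>
    (hLx x).mul_bdd (c := C) hf.aestronglyMeasurable (Filter.Eventually.of_forall hb)
  set G : E3 → ℝ := fun x => ∫ y, Lfun τ x y * f y ∂ρ with hG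
  have hGi : Integrable G ρ := hLf.integral_prod_left
  have hell := intg_of_cont ρ h0 (continuous_ell τ ρ h0)
  have hmulf : ∀ g : E3 → ℝ, Integrable g ρ → Integrable (fun x => g x * f x) ρ := fun g hg =>
    hg.mul_bdd (c := C) hf.aestronglyMeasurable (Filter.Eventually.of_forall hb)
  have e1 : ∫ x, ell τ ρ x * f x ∂ρ = S * m := by
    have : ∫ x, ell τ ρ x * f x ∂ρ = ∫ x, S * f x ∂ρ := by
      apply integral_congr_ae
      filter_upwards [hae] with x hx
      rw [hx]
    rw [this, integral_const_mul]
  have e2 : ∫ x, G x ∂ρ = S * m := by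
    rw [← e1]
    simp only [hG]
    rw [integral_integral_swap (f := fun x y => Lfun τ x y * f y) hLf]
    apply integral_congr_ae
    refine Filter.Eventually.of_forall fun y => ?_
    simp only [integral_mul_const, ell]
    congr 1
    simp_rw [fun x => Lfun_symm τ x y]
  have e3 : ∫ x, ell τ ρ x ∂ρ = S := rfl
  have hSn : 0 ≤ S := by
    rw [hS]; unfold causalAction
    refine integral_nonneg fun x => integral_nonneg fun y => le_max_left _ _
  have : ∀ x, ∫ y, Lfun τ x y * (f y - m) ∂ρ = G x - m * ell τ ρ x := by
    intro x
    simp_rw [mul_sub]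
    rw [integral_sub (hLfx x) ((hLx x).mul_const _), integral_mul_const, mul_comm m]
    rfl
  simp_rw [this] at key
  have h4 : ∀ x, (G x - m * ell τ ρ x) * (f x - m) =
      (G x * f x - m * (ell τ ρ x * f x)) - (m * G x - m ^ 2 * ell τ ρ x) := by intro x; ring
  simp_rw [h4] at key
  have i1 := hmulf _ hGi
  have i2 := (hmulf _ hell).const_mul m
  have i3 := hGi.const_mul m
  have i4 := hell.const_mul (m ^ 2)
  have h5 : ∫ x, (G x * f x - m * (ell τ ρ x * f x) - (m * G x - m ^ 2 * ell τ ρ x)) ∂ρ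
      = (∫ x, G x * f x ∂ρ - m * (S * m)) - (m * (S * m) - m ^ 2 * S) := by
    have j := integral_sub (i1.sub i2) (i3.sub i4)
    have j1 := integral_sub i1 i2
    have j2 := integral_sub i3 i4
    rw [integral_const_mul, e1] at j1
    rw [integral_const_mul, integral_const_mul, e2, e3] at j2
    rw [← j1, ← j2]
    exact j
  rw [h5] at key
  have : 0 ≤ S * m ^ 2 := by positivity
  nlinarith

lemma avg_close (ρ : Measure E3) [IsProbabilityMeasure ρ] (B : Set E3) (hB : MeasurableSet B)
    (hpos : 0 < ρ.real B) (g : E3 → ℝ) (hg : IntegrableOn g B ρ) (c η : ℝ)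
    (h : ∀ x ∈ B, |g x - c| ≤ η) : |(∫ x in B, g x ∂ρ) / ρ.real B - c| ≤ η := by
  have h1 := norm_setIntegral_le_of_norm_le_const (μ := ρ) (f := fun x => g x - c) (C := η)
    (measure_lt_top ρ B) h
  have h2 : ∫ x in B, (g x - c) ∂ρ = (∫ x in B, g x ∂ρ) - ρ.real B * c := by
    rw [integral_sub hg (integrable_const _)]; simp
  rw [h2, Real.norm_eq_abs] at h1
  have : (∫ x in B, g x ∂ρ) / ρ.real B - c = ((∫ x in B, g x ∂ρ) - ρ.real B * c) / ρ.real B := by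
    field_simp
  rw [this, abs_div, abs_of_pos hpos, div_le_iff₀ hpos]
  exact h1

lemma psd (τ : ℝ) (ρ : Measure E3) (hm : IsMinimizer τ ρ) (ι : Type) [Fintype ι] (x : ι → E3)
    (hx : ∀ i, x i ∈ msupport ρ) (w : ι → ℝ) :
    0 ≤ ∑ i, ∑ j, w i * w j * Lfun τ (x i) (x j) := by
  have hm' := hm
  obtain ⟨hp, hr, h0, hmin⟩ := hm
  have hLx : ∀ x, Integrable (fun y => Lfun τ x y) ρ := fun x =>
    intg_of_cont ρ h0 (continuous_Lfun_right τ x)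
  -- approximate
  have key : ∀ η > 0, 0 ≤ ∑ i, ∑ j, (w i * w j * Lfun τ (x i) (x j) + |w i * w j| * η) := by
    intro η hη
    -- choose a radius
    have hcont : ∀ i j, ∃ δ > 0, ∀ a ∈ Metric.ball (x i) δ, ∀ b ∈ Metric.ball (x j) δ,
        |Lfun τ a b - Lfun τ (x i) (x j)| ≤ η := by
      intro i j
      obtain ⟨δ, hδ, h⟩ := Metric.continuousAt_iff.1
        ((continuous_Lfun τ).continuousAt (x := (x i, x j))) η hη
      refine ⟨δ, hδ, fun a ha b hb => ?_⟩
      have := @h (a, b) (by rw [Prod.dist_eq]; exact max_lt ha hb)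
      rw [Real.dist_eq] at this
      exact this.le
    choose δ hδ hδ' using hcont
    obtain ⟨r, hr0, hr1⟩ : ∃ r > 0, ∀ i j, r ≤ δ i j := by
      have hfin : (Set.range fun p : ι × ι => δ p.1 p.2).Finite := Set.finite_range _
      by_cases hne : Nonempty (ι × ι)
      · obtain ⟨p, hp⟩ := Finite.exists_min (fun p : ι × ι => δ p.1 p.2)
        exact ⟨δ p.1 p.2, hδ _ _, fun i j => hp (i, j)⟩
      · exact ⟨1, one_pos, fun i j => (hne ⟨(i, j)⟩).elim⟩
    set B : ι → Set E3 := fun i => Metric.ball (x i) r with hB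
    have hBm : ∀ i, MeasurableSet (B i) := fun i => Metric.isOpen_ball.measurableSet
    have hBp : ∀ i, 0 < ρ.real (B i) := fun i =>
      ENNReal.toReal_pos (hx i _ Metric.isOpen_ball (Metric.mem_ball_self hr0)).ne'
        (measure_ne_top _ _)
    have hBL : ∀ i j, ∀ a ∈ B i, ∀ b ∈ B j, |Lfun τ a b - Lfun τ (x i) (x j)| ≤ η :=
      fun i j a ha b hb => hδ' i j a (Metric.ball_subset_ball (hr1 i j) ha) b
        (Metric.ball_subset_ball (hr1 i j) hb)
    set f : E3 → ℝ := fun z => ∑ i, w i / ρ.real (B i) * (B i).indicator 1 z with hf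
    have hfm : Measurable f := by
      refine Finset.measurable_sum _ fun i _ => ?_
      exact (measurable_const.indicator (hBm i)).const_mul _
    have hfb : ∀ z, |f z| ≤ (∑ i, |w i / ρ.real (B i)|) + 1 := by
      intro z
      refine (Finset.abs_sum_le_sum_abs _ _).trans (le_trans (Finset.sum_le_sum fun i _ => ?_)
        (le_add_of_nonneg_right zero_le_one))
      rw [abs_mul]
      refine mul_le_of_le_one_right (abs_nonneg _) ?_
      by_cases hz : z ∈ B i <;> simp [hz]
    have hq := quad_nonneg τ ρ hm' f hfm _ (by positivity) hfb
    have hmain : ∀ g : E3 → ℝ, Integrable g ρ →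
        ∫ z, g z * f z ∂ρ = ∑ i, w i * ((∫ z in B i, g z ∂ρ) / ρ.real (B i)) := by
      intro g hg
      have : ∀ z, g z * f z = ∑ i, w i / ρ.real (B i) * (B i).indicator g z := by
        intro z
        rw [hf, Finset.mul_sum]
        refine Finset.sum_congr rfl fun i _ => ?_
        by_cases hz : z ∈ B i <;> simp [hz]; ring
      simp_rw [this]
      rw [integral_finsetSum]
      · refine Finset.sum_congr rfl fun i _ => ?_
        rw [integral_const_mul, integral_indicator (hBm i)]; ring
      · intro i _
        exact (hg.indicator (hBm i)).const_mul _
    simp_rw [fun a => hmain _ (hLx a)] at hq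
    have hcontL : ∀ j, Continuous fun a => ∫ b in B j, Lfun τ a b ∂ρ := by
      intro j
      have := continuous_ell τ (ρ.restrict (B j)) (by
        exact Measure.absolutelyContinuous_of_le Measure.restrict_le_self h0)
      exact this
    have hGi : ∀ j, Integrable (fun a => (∫ b in B j, Lfun τ a b ∂ρ) / ρ.real (B j)) ρ := fun j =>
      (intg_of_cont ρ h0 (hcontL j)).div_const _
    have hGi' : Integrable (fun a => ∑ j, w j * ((∫ b in B j, Lfun τ a b ∂ρ) / ρ.real (B j))) ρ :=
      integrable_finsetSum _ fun j _ => (hGi j).const_mul _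
    rw [hmain _ hGi'] at hq
    refine hq.trans (Finset.sum_le_sum fun i _ => ?_)
    rw [integral_finsetSum _ fun j _ => ((hGi j).const_mul _).integrableOn, Finset.sum_div,
      Finset.mul_sum]
    refine Finset.sum_le_sum fun j _ => ?_
    rw [integral_const_mul]
    have hh := avg_close ρ (B i) (hBm i) (hBp i) _ (hGi j).integrableOn (Lfun τ (x i) (x j)) η
      (fun a ha => avg_close ρ (B j) (hBm j) (hBp j) _ (hLx a).integrableOn _ η
        (fun b hb => hBL i j a ha b hb))
    set A := (∫ a in B i, (∫ b in B j, Lfun τ a b ∂ρ) / ρ.real (B j) ∂ρ) / ρ.real (B i) with hA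
    have e : w i * (w j * (∫ a in B i, (∫ b in B j, Lfun τ a b ∂ρ) / ρ.real (B j) ∂ρ)
        / ρ.real (B i)) = w i * w j * Lfun τ (x i) (x j) +
          w i * w j * (A - Lfun τ (x i) (x j)) := by rw [hA]; ring
    rw [e]
    refine add_le_add le_rfl ?_
    refine (le_abs_self _).trans ?_
    rw [abs_mul]
    exact mul_le_mul_of_nonneg_left hh (abs_nonneg _)
  set T := ∑ i, ∑ j, w i * w j * Lfun τ (x i) (x j) with hT
  set W := ∑ i, ∑ j, |w i * w j| with hW
  have key2 : ∀ η > 0, 0 ≤ T + W * η := by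
    intro η hη
    have := key η hη
    simp_rw [Finset.sum_add_distrib, ← Finset.sum_mul] at this
    exact this
  have hW0 : 0 ≤ W := by positivity
  by_contra hneg
  push Not at hneg
  have := key2 (-T / (2 * (W + 1))) (by apply div_pos <;> linarith)
  have h3 : W * (-T / (2 * (W + 1))) ≤ -T / 2 := by
    rw [← mul_div_assoc, div_le_div_iff₀ (by linarith) two_pos]
    nlinarith
  linarith

noncomputable def DX (τ X : ℝ) : ℝ := (1 / 4) * (1 + X) * (2 - τ ^ 2 * (1 - X))

lemma Lfun_eq_DX (τ : ℝ) (x y : E3) : Lfun τ x y = max 0 (DX τ ⟪x, y⟫) := rfl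

lemma norm_of_sphere {x : E3} (h : x ∈ Sphere2) : ‖x‖ = 1 := by
  simpa [Sphere2] using h

lemma abs_inner_le_one {x y : E3} (hx : ‖x‖ = 1) (hy : ‖y‖ = 1) : |⟪x, y⟫| ≤ 1 := by
  have := abs_real_inner_le_norm x y
  rwa [hx, hy, mul_one] at this

lemma DX_nonneg {τ X : ℝ} (hτ : 0 < τ) (h1 : -1 ≤ X) (h : 1 - 2 / τ ^ 2 ≤ X) : 0 ≤ DX τ X := by
  unfold DX
  have : τ ^ 2 * (1 - X) ≤ 2 := by
    have : τ ^ 2 * (1 - X) ≤ τ ^ 2 * (2 / τ ^ 2) := by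
      apply mul_le_mul_of_nonneg_left (by linarith) (by positivity)
    rwa [mul_div_cancel₀ _ (by positivity)] at this
  apply mul_nonneg <;> linarith

lemma DX_nonpos {τ X : ℝ} (hτ : 0 < τ) (h1 : -1 ≤ X) (h : X ≤ 1 - 2 / τ ^ 2) : DX τ X ≤ 0 := by
  unfold DX
  have : 2 ≤ τ ^ 2 * (1 - X) := by
    have : τ ^ 2 * (2 / τ ^ 2) ≤ τ ^ 2 * (1 - X) := by
      apply mul_le_mul_of_nonneg_left (by linarith) (by positivity)
    rwa [mul_div_cancel₀ _ (by positivity)] at this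
  apply mul_nonpos_of_nonneg_of_nonpos <;> linarith

lemma Lfun_eq_D_of_near {τ : ℝ} (hτ : 0 < τ) {x y : E3} (hx : ‖x‖ = 1) (hy : ‖y‖ = 1)
    (h : ‖x - y‖ ≤ 2 / τ) : Lfun τ x y = Dfun τ x y := by
  have h1 := norm_sub_sq_real x y
  rw [hx, hy] at h1
  have h2 : ‖x - y‖ ^ 2 ≤ 4 / τ ^ 2 := by
    calc ‖x - y‖ ^ 2 ≤ (2 / τ) ^ 2 := by gcongr
      _ = 4 / τ ^ 2 := by ring
  have h3 : (1 : ℝ) - 2 / τ ^ 2 ≤ ⟪x, y⟫ := by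
    have : (4 : ℝ) / τ ^ 2 = 2 * (2 / τ ^ 2) := by ring
    linarith
  have := abs_le.1 (abs_inner_le_one hx hy)
  exact max_eq_right (DX_nonneg hτ this.1 h3)

lemma Lfun_lip {τ : ℝ} {x y q : E3} (hx : ‖x‖ = 1) (hy : ‖y‖ = 1) (hq : ‖q‖ = 1) :
    |Lfun τ x q - Lfun τ y q| ≤ (1 + τ ^ 2) * ‖x - y‖ := by
  have h1 := abs_le.1 (abs_inner_le_one hx hq)
  have h2 := abs_le.1 (abs_inner_le_one hy hq)
  have h3 : |⟪x, q⟫ - ⟪y, q⟫| ≤ ‖x - y‖ := by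
    rw [← inner_sub_left]
    have := abs_real_inner_le_norm (x - y) q
    rwa [hq, mul_one] at this
  rw [Lfun_eq_DX, Lfun_eq_DX, max_comm, max_comm 0]
  refine (abs_max_sub_max_le_abs _ _ _).trans ?_
  have : DX τ ⟪x, q⟫ - DX τ ⟪y, q⟫ =
      (⟪x, q⟫ - ⟪y, q⟫) * ((2 + τ ^ 2 * (⟪x, q⟫ + ⟪y, q⟫)) / 4) := by unfold DX; ring
  rw [this, abs_mul, mul_comm]
  refine mul_le_mul ?_ h3 (abs_nonneg _) (by positivity)
  rw [abs_le]
  constructor <;> nlinarith [sq_nonneg τ]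

/-- tensor-type bound -/
lemma four_pt_N (p h1 h2 : E3) (s t : ℝ) (hs : 0 ≤ s) (ht : 0 ≤ t) (hp : ‖p‖ = 1) (a b : E3) :
    |⟪p, a⟫ * ⟪t • h1 + s • h2, b⟫ + ⟪t • h1 + s • h2, a⟫ * ⟪p, b⟫ + t * (⟪h1, a⟫ * ⟪h1, b⟫)
      + s * (⟪h2, a⟫ * ⟪h2, b⟫)|
    ≤ ‖a‖ * ‖b‖ * (2 * ‖t • h1 + s • h2‖ + t * ‖h1‖ ^ 2 + s * ‖h2‖ ^ 2) := by
  set z := t • h1 + s • h2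
  have e : ∀ u w : E3, |⟪u, a⟫ * ⟪w, b⟫| ≤ ‖u‖ * ‖a‖ * (‖w‖ * ‖b‖) := by
    intro u w
    rw [abs_mul]
    exact mul_le_mul (abs_real_inner_le_norm _ _) (abs_real_inner_le_norm _ _) (abs_nonneg _)
      (by positivity)
  have e1 := e p z
  have e2 := e z p
  have e3 := e h1 h1
  have e4 := e h2 h2
  rw [hp] at e1 e2
  have f3 : |t * (⟪h1, a⟫ * ⟪h1, b⟫)| ≤ t * (‖h1‖ * ‖a‖ * (‖h1‖ * ‖b‖)) := by
    rw [abs_mul, abs_of_nonneg ht]; gcongr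
  have f4 : |s * (⟪h2, a⟫ * ⟪h2, b⟫)| ≤ s * (‖h2‖ * ‖a‖ * (‖h2‖ * ‖b‖)) := by
    rw [abs_mul, abs_of_nonneg hs]; gcongr
  refine (abs_add_le _ _).trans ((add_le_add ((abs_add_le _ _).trans
    (add_le_add ((abs_add_le _ _).trans (add_le_add e1 e2)) f3)) f4).trans ?_)
  apply le_of_eq; ring

lemma four_pt_D (τ : ℝ) (p h1 h2 : E3) (s t : ℝ) (hs : 0 ≤ s) (ht : 0 ≤ t) (hp : ‖p‖ = 1)
    (Λ : ℝ) (hΛ : 2 * ‖t • h1 + s • h2‖ + t * ‖h1‖ ^ 2 + s * ‖h2‖ ^ 2 ≤ Λ) (w : Fin 3 → ℝ)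
    (x : Fin 3 → E3) (hw : w = ![t, -(s + t), s]) (hx : x = ![p + h1, p, p + h2]) :
    ∑ i, ∑ j, w i * w j * Dfun τ (x i) (x j) ≤ (1 + τ ^ 2) * Λ ^ 2 := by
  set z := t • h1 + s • h2 with hz
  set Λ0 := 2 * ‖z‖ + t * ‖h1‖ ^ 2 + s * ‖h2‖ ^ 2 with hΛ0
  have hΛp : 0 ≤ Λ0 := by positivity
  have T := four_pt_N p h1 h2 s t hs ht hp
  rw [← hz, ← hΛ0] at T
  have T1 := (le_abs_self _).trans (T p z)
  have T3 := (le_abs_self _).trans (T h1 h1)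
  have T4 := (le_abs_self _).trans (T h2 h2)
  rw [hp] at T1
  have hzz : ‖z‖ ≤ Λ0 / 2 := by
    have : 0 ≤ t * ‖h1‖ ^ 2 + s * ‖h2‖ ^ 2 := by positivity
    linarith
  have hN := add_le_add (add_le_add T1 T1) (add_le_add (mul_le_mul_of_nonneg_left T3 ht)
    (mul_le_mul_of_nonneg_left T4 hs))
  have key : ∑ i, ∑ j, w i * w j * Dfun τ (x i) (x j) ≤ (1/4) * (2 * ‖z‖ ^ 2 + τ ^ 2 * Λ0 ^ 2) := by
    have hz2 : ‖z‖ ^ 2 = ⟪z, z⟫ := (real_inner_self_eq_norm_sq z).symm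
    have hR : 1 * ‖z‖ * Λ0 + 1 * ‖z‖ * Λ0 + (t * (‖h1‖ * ‖h1‖ * Λ0) + s * (‖h2‖ * ‖h2‖ * Λ0))
        = Λ0 ^ 2 := by rw [sq Λ0]; nth_rewrite 5 [hΛ0]; ring
    rw [hR] at hN
    have hN' := mul_le_mul_of_nonneg_left hN (sq_nonneg τ)
    rw [hz2]
    have hpp : ⟪p, p⟫ = (1 : ℝ) := by rw [real_inner_self_eq_norm_sq, hp]; norm_num
    refine le_trans (le_of_eq ?_) (mul_le_mul_of_nonneg_left
      (add_le_add_right hN' (2 * ⟪z, z⟫)) (by norm_num : (0:ℝ) ≤ 1/4))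
    subst hw hx
    simp only [Fin.sum_univ_three, Dfun, hz, Matrix.cons_val, inner_add_left, inner_add_right,
      real_inner_smul_left, real_inner_smul_right, hpp]
    rw [real_inner_comm p h1, real_inner_comm p h2, real_inner_comm h1 h2]
    ring
  refine key.trans ?_
  have h2 : ‖z‖ ^ 2 ≤ Λ0 ^ 2 := by
    apply pow_le_pow_left₀ (norm_nonneg _); linarith
  have h3 : Λ0 ^ 2 ≤ Λ ^ 2 := pow_le_pow_left₀ hΛp hΛ _
  nlinarith [sq_nonneg τ, sq_nonneg Λ0, mul_le_mul_of_nonneg_left h3 (sq_nonneg τ)]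

set_option maxHeartbeats 1000000 in
lemma K_bound (τ : ℝ) (hτ : 0 < τ) (ρ : Measure E3) (hm : IsMinimizer τ ρ) (p v x y q : E3)
    (hpM : p ∈ msupport ρ) (hxM : x ∈ msupport ρ) (hyM : y ∈ msupport ρ) (hqM : q ∈ msupport ρ)
    (hv : ‖v‖ = 1) (C s t : ℝ) (hC : 0 ≤ C) (hs : 0 < s) (ht : 0 < t)
    (hCs : C * s ≤ 1) (hCt : C * t ≤ 1) (hs' : 2 * s ≤ 1 / τ) (ht' : 2 * t ≤ 1 / τ)
    (hx : ‖x - p - s • v‖ ≤ C * s ^ 2) (hy : ‖y - p + t • v‖ ≤ C * t ^ 2) :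
    |t * Lfun τ x q - (s + t) * Lfun τ p q + s * Lfun τ y q| ≤
      (1 + τ) * (2 * C + 4) * (s * t * (s + t)) := by
  have hsub := msupport_sub ρ hm.2.2.1
  have np := norm_of_sphere (hsub hpM)
  have nx := norm_of_sphere (hsub hxM)
  have ny := norm_of_sphere (hsub hyM)
  have nq := norm_of_sphere (hsub hqM)
  obtain ⟨h1, e1⟩ : ∃ h1, x = p + h1 := ⟨x - p, by abel⟩
  obtain ⟨h2, e2⟩ : ∃ h2, y = p + h2 := ⟨y - p, by abel⟩
  have hx1 : ‖h1 - s • v‖ ≤ C * s ^ 2 := by rwa [e1, add_sub_cancel_left] at hx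
  have hy1 : ‖h2 + t • v‖ ≤ C * t ^ 2 := by rwa [e2, add_sub_cancel_left] at hy
  have n1 : ‖h1‖ ≤ 2 * s := by
    have : h1 = (h1 - s • v) + s • v := by abel
    rw [this]
    refine (norm_add_le _ _).trans ?_
    rw [norm_smul, hv, Real.norm_of_nonneg hs.le]
    nlinarith
  have n2 : ‖h2‖ ≤ 2 * t := by
    have : h2 = (h2 + t • v) - t • v := by abel
    rw [this]
    refine (norm_sub_le _ _).trans ?_
    rw [norm_smul, hv, Real.norm_of_nonneg ht.le]
    nlinarith
  have nz : ‖t • h1 + s • h2‖ ≤ C * (s * t * (s + t)) := by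
    have : t • h1 + s • h2 = t • (h1 - s • v) + s • (h2 + t • v) := by
      simp only [smul_sub, smul_add, smul_smul, mul_comm]; abel
    rw [this]
    refine (norm_add_le _ _).trans ?_
    rw [norm_smul, norm_smul, Real.norm_of_nonneg hs.le, Real.norm_of_nonneg ht.le]
    calc t * ‖h1 - s • v‖ + s * ‖h2 + t • v‖ ≤ t * (C * s ^ 2) + s * (C * t ^ 2) := by gcongr
      _ = _ := by ring
  have hΛ : 2 * ‖t • h1 + s • h2‖ + t * ‖h1‖ ^ 2 + s * ‖h2‖ ^ 2
      ≤ (2 * C + 4) * (s * t * (s + t)) := by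
    calc _ ≤ 2 * (C * (s * t * (s + t))) + t * (2 * s) ^ 2 + s * (2 * t) ^ 2 := by gcongr
      _ = _ := by ring
  have hD := four_pt_D τ p h1 h2 s t hs.le ht.le np _ hΛ _ _ rfl rfl
  rw [← e1, ← e2] at hD
  set K := t * Lfun τ x q - (s + t) * Lfun τ p q + s * Lfun τ y q with hK
  have hpsd := psd τ ρ hm (Fin 4) ![x, p, y, q]
    (by intro i; fin_cases i <;> simpa) ![t, -(s + t), s, -K]
  have ip : 0 < 1 / τ := by positivity
  have dxy : ‖x - y‖ ≤ 2 / τ := by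
    rw [e1, e2, add_sub_add_left_eq_sub]
    refine (norm_sub_le _ _).trans ?_
    have : 2 / τ = 1 / τ + 1 / τ := by ring
    linarith
  have dxp : ‖x - p‖ ≤ 2 / τ := by
    rw [e1, add_sub_cancel_left]
    have : 2 / τ = 1 / τ + 1 / τ := by ring
    linarith
  have dyp : ‖y - p‖ ≤ 2 / τ := by
    rw [e2, add_sub_cancel_left]
    have : 2 / τ = 1 / τ + 1 / τ := by ring
    linarith
  have self : ∀ u : E3, ‖u‖ = 1 → Lfun τ u u = Dfun τ u u := fun u hu =>
    Lfun_eq_D_of_near hτ hu hu (by simp; positivity)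
  have hqq : Lfun τ q q = 1 := by
    rw [self q nq, Dfun, real_inner_self_eq_norm_sq, nq]; norm_num
  have a1 := Lfun_eq_D_of_near hτ nx ny dxy
  have a2 := Lfun_eq_D_of_near hτ nx np dxp
  have a3 := Lfun_eq_D_of_near hτ ny np dyp
  have a1' := Lfun_eq_D_of_near hτ ny nx (by rwa [norm_sub_rev])
  have a2' := Lfun_eq_D_of_near hτ np nx (by rwa [norm_sub_rev])
  have a3' := Lfun_eq_D_of_near hτ np ny (by rwa [norm_sub_rev])
  have hsq : K ^ 2 ≤ (1 + τ ^ 2) * ((2 * C + 4) * (s * t * (s + t))) ^ 2 := by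
    refine le_trans ?_ hD
    simp only [Fin.sum_univ_three, Fin.sum_univ_four, Matrix.cons_val] at hpsd ⊢
    rw [a1, a2, a3, a1', a2', a3', hqq, self x nx, self y ny, self p np, Lfun_symm τ q x,
      Lfun_symm τ q p, Lfun_symm τ q y] at hpsd
    refine le_of_sub_nonneg (hpsd.trans_eq ?_)
    rw [hK]
    ring
  apply abs_le_of_sq_le_sq _ (by positivity)
  refine hsq.trans ?_
  have e : ((1 + τ) * (2 * C + 4) * (s * t * (s + t))) ^ 2
      = (1 + τ) ^ 2 * ((2 * C + 4) * (s * t * (s + t))) ^ 2 := by ring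
  rw [e]
  exact mul_le_mul_of_nonneg_right (by nlinarith) (sq_nonneg _)

noncomputable def geo (p v : E3) (a : ℝ) : E3 := Real.cos a • p + Real.sin a • v

lemma geo_zero (p v : E3) : geo p v 0 = p := by simp [geo]

lemma geo_inner (p v q : E3) (a : ℝ) :
    ⟪geo p v a, q⟫ = Real.cos a * ⟪p, q⟫ + Real.sin a * ⟪v, q⟫ := by
  simp only [geo, inner_add_left, real_inner_smul_left]

lemma geo_norm {p v : E3} (hp : ‖p‖ = 1) (hv : ‖v‖ = 1) (h : ⟪p, v⟫ = (0 : ℝ)) (a : ℝ) :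
    ‖geo p v a‖ = 1 := by
  have h1 : ‖geo p v a‖ ^ 2 = 1 := by
    have hvp : ⟪v, p⟫ = (0 : ℝ) := by rw [real_inner_comm]; exact h
    have PP : ⟪p, p⟫ = (1 : ℝ) := by rw [real_inner_self_eq_norm_sq, hp]; norm_num
    have VV : ⟪v, v⟫ = (1 : ℝ) := by rw [real_inner_self_eq_norm_sq, hv]; norm_num
    rw [← real_inner_self_eq_norm_sq]
    simp only [geo, inner_add_left, inner_add_right, real_inner_smul_left, real_inner_smul_right,
      h, hvp, PP, VV]
    nlinarith [Real.sin_sq_add_cos_sq a]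
  nlinarith [norm_nonneg (geo p v a)]

lemma geo_near {p v : E3} (hp : ‖p‖ = 1) (hv : ‖v‖ = 1) (a : ℝ) (h0 : 0 < a) (h1 : a ≤ 1) :
    ‖geo p v a - p - a • v‖ ≤ a ^ 2 := by
  have : geo p v a - p - a • v = (Real.cos a - 1) • p + (Real.sin a - a) • v := by
    unfold geo; simp only [sub_smul, one_smul]; abel
  rw [this]
  refine (norm_add_le _ _).trans ?_
  rw [norm_smul, norm_smul, hp, hv, mul_one, mul_one, Real.norm_eq_abs, Real.norm_eq_abs]
  have c1 := Real.one_sub_sq_div_two_le_cos (x := a)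
  have c2 := Real.cos_le_one a
  have s1 := Real.sin_gt_sub_cube h0
  have s2 := Real.sin_le h0.le
  rw [abs_of_nonpos (by linarith), abs_of_nonpos (by linarith)]
  have : a ^ 3 ≤ a ^ 2 := by nlinarith [sq_nonneg a]
  nlinarith

lemma geo_neg (p v : E3) (a : ℝ) : geo p v (-a) = geo p (-v) a := by simp [geo]

lemma Kgeo_bound (τ : ℝ) (hτ : 0 < τ) (ρ : Measure E3) (hm : IsMinimizer τ ρ) (p v x y q : E3)
    (hpM : p ∈ msupport ρ) (hxM : x ∈ msupport ρ) (hyM : y ∈ msupport ρ) (hqM : q ∈ msupport ρ)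
    (hv : ‖v‖ = 1) (hpv : ⟪p, v⟫ = (0 : ℝ)) (C s t : ℝ) (hC : 0 ≤ C) (hs : 0 < s) (ht : 0 < t)
    (hs1 : s ≤ 1) (ht1 : t ≤ 1)
    (hCs : C * s ≤ 1) (hCt : C * t ≤ 1) (hs' : 2 * s ≤ 1 / τ) (ht' : 2 * t ≤ 1 / τ)
    (hx : ‖x - p - s • v‖ ≤ C * s ^ 2) (hy : ‖y - p + t • v‖ ≤ C * t ^ 2) :
    |t * Lfun τ (geo p v s) q - (s + t) * Lfun τ p q + s * Lfun τ (geo p v (-t)) q| ≤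
      ((1 + τ) * (2 * C + 4) + (1 + τ ^ 2) * (C + 1)) * (s * t * (s + t)) := by
  have hK := K_bound τ hτ ρ hm p v x y q hpM hxM hyM hqM hv C s t hC hs ht hCs hCt hs' ht' hx hy
  have hsub := msupport_sub ρ hm.2.2.1
  have np := norm_of_sphere (hsub hpM)
  have nx := norm_of_sphere (hsub hxM)
  have ny := norm_of_sphere (hsub hyM)
  have nq := norm_of_sphere (hsub hqM)
  have g1 : ‖geo p v s - x‖ ≤ (C + 1) * s ^ 2 := by
    have : geo p v s - x = (geo p v s - p - s • v) - (x - p - s • v) := by abel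
    rw [this]
    refine (norm_sub_le _ _).trans ?_
    have := geo_near np hv s hs hs1
    linarith
  have g2 : ‖geo p v (-t) - y‖ ≤ (C + 1) * t ^ 2 := by
    have : geo p v (-t) - y = (geo p (-v) t - p - t • (-v)) - (y - p + t • v) := by
      rw [geo_neg, smul_neg]; abel
    rw [this]
    refine (norm_sub_le _ _).trans ?_
    have := geo_near np (by rwa [norm_neg] : ‖-v‖ = 1) t ht ht1
    linarith
  have l1 := Lfun_lip (τ := τ) (geo_norm np hv hpv s) nx nq
  have l2 := Lfun_lip (τ := τ) (geo_norm np hv hpv (-t)) ny nq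
  have l1' : t * |Lfun τ (geo p v s) q - Lfun τ x q| ≤ t * ((1 + τ ^ 2) * ((C + 1) * s ^ 2)) := by
    gcongr; exact l1.trans (by gcongr)
  have l2' : s * |Lfun τ (geo p v (-t)) q - Lfun τ y q| ≤
      s * ((1 + τ ^ 2) * ((C + 1) * t ^ 2)) := by
    gcongr; exact l2.trans (by gcongr)
  have e : t * Lfun τ (geo p v s) q - (s + t) * Lfun τ p q + s * Lfun τ (geo p v (-t)) q
      = (t * Lfun τ x q - (s + t) * Lfun τ p q + s * Lfun τ y q)
        + (t * (Lfun τ (geo p v s) q - Lfun τ x q) + s * (Lfun τ (geo p v (-t)) q - Lfun τ y q)) := by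
    ring
  rw [e]
  refine (abs_add_le _ _).trans ?_
  have h3 := abs_add_le (t * (Lfun τ (geo p v s) q - Lfun τ x q))
    (s * (Lfun τ (geo p v (-t)) q - Lfun τ y q))
  rw [abs_mul, abs_mul, abs_of_pos hs, abs_of_pos ht] at h3
  have : t * ((1 + τ ^ 2) * ((C + 1) * s ^ 2)) + s * ((1 + τ ^ 2) * ((C + 1) * t ^ 2))
    = (1 + τ ^ 2) * (C + 1) * (s * t * (s + t)) := by ring
  rw [add_mul ((1 + τ) * (2 * C + 4))]
  linarith

/-- concavity on timelike region -/
lemma concave_bound (τ : ℝ) (hτ : Real.sqrt 6 < τ) : ∃ c > 0, ∀ α β : ℝ, α ^ 2 + β ^ 2 ≤ 1 →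
    ∀ δ > 0, (∀ a ∈ Icc (-δ) δ, 1 - 2 / τ ^ 2 ≤ Real.cos a * α + Real.sin a * β) →
    ∀ s t : ℝ, 0 < s → 0 < t → s ≤ δ → t ≤ δ →
    t * DX τ (Real.cos s * α + Real.sin s * β) - (s + t) * DX τ α +
      s * DX τ (Real.cos (-t) * α + Real.sin (-t) * β) ≤ - c * (s * t * (s + t)) := by
  have hτ0 : 0 < τ := lt_of_le_of_lt (Real.sqrt_nonneg _) hτ
  have hu : 6 < τ ^ 2 := by
    have := (Real.sqrt_lt (by norm_num) hτ0.le).1 hτ; exact this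
  obtain ⟨u, hu'⟩ : ∃ u, u = τ ^ 2 := ⟨_, rfl⟩
  set c := (u - 1) * (u - 6) / (2 * u) with hc
  have hcpos : 0 < c := by
    apply div_pos (mul_pos _ _) <;> linarith
  refine ⟨c / 2, by positivity, ?_⟩
  intro α β hab δ hδ hX s t hs ht hsδ htδ
  set X : ℝ → ℝ := fun a => Real.cos a * α + Real.sin a * β with hXd
  set X' : ℝ → ℝ := fun a => -Real.sin a * α + Real.cos a * β with hXd'
  have dX : ∀ a, HasDerivAt X (X' a) a := fun a =>
    ((Real.hasDerivAt_cos a).mul_const α).add ((Real.hasDerivAt_sin a).mul_const β)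
  have dX' : ∀ a, HasDerivAt X' (-X a) a := fun a => by
    have := ((Real.hasDerivAt_sin a).neg.mul_const α).add ((Real.hasDerivAt_cos a).mul_const β)
    exact this.congr_deriv (by simp only [hXd]; ring)
  set G : ℝ → ℝ := fun a => DX τ (X a) + c / 2 * a ^ 2 with hG
  set G' : ℝ → ℝ := fun a => (1 / 2) * X' a + (u / 2) * (X a * X' a) + c * a with hG'
  have dG : ∀ a, HasDerivAt G (G' a) a := by
    intro a
    have h1 : HasDerivAt (fun X => DX τ X)
        ((1 / 2) + (u / 2) * X a) (X a) := by
      have hh : (fun X => DX τ X) = fun X => (1/4) * (2 - u) + (1/2) * X + (u/4) * X ^ 2 := by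
        funext X; unfold DX; rw [hu']; ring
      rw [hh]
      have := (((hasDerivAt_id (X a)).const_mul (1/2)).const_add ((1/4) * (2 - u))).add
        (((hasDerivAt_id (X a)).pow 2).const_mul (u/4))
      exact this.congr_deriv (by simp; ring)
    have h2 := (h1.comp a (dX a)).add (((hasDerivAt_id a).pow 2).const_mul (c/2))
    exact h2.congr_deriv (by simp [hG']; ring)
  have dG' : ∀ a, HasDerivAt G' ((1 / 2) * (-X a) + (u / 2) * (X' a * X' a + X a * (-X a)) + c) a := by
    intro a
    have := (((dX' a).const_mul (1/2)).add (((dX a).mul (dX' a)).const_mul (u/2))).add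
      ((hasDerivAt_id a).const_mul c)
    exact this.congr_deriv (by simp)
  have deq : deriv G = G' := funext fun a => (dG a).deriv
  have hconc : ConcaveOn ℝ (Icc (-δ) δ) G := by
    apply concaveOn_of_deriv2_nonpos (convex_Icc _ _)
    · exact fun a _ => (dG a).continuousAt.continuousWithinAt
    · exact fun a _ => (dG a).differentiableAt.differentiableWithinAt
    · rw [deq]; exact fun a _ => (dG' a).differentiableAt.differentiableWithinAt
    · intro a ha
      have ha' := interior_subset ha
      simp only [Function.iterate_succ, Function.iterate_zero, Function.comp, id]
      rw [deq, (dG' a).deriv]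
      have hXa := hX a ha'
      have hsum : X a ^ 2 + X' a ^ 2 ≤ 1 := by
        have : X a ^ 2 + X' a ^ 2 = (Real.sin a ^ 2 + Real.cos a ^ 2) * (α ^ 2 + β ^ 2) := by
          simp only [hXd, hXd']; ring
        rw [this, Real.sin_sq_add_cos_sq, one_mul]; exact hab
      change 1 - 2 / τ ^ 2 ≤ X a at hXa
      rw [← hu'] at hXa hu
      have hup : 0 < u := by linarith
      obtain ⟨r, hr⟩ : ∃ r, r = 1 / u := ⟨_, rfl⟩
      have hru : r * u = 1 := by rw [hr]; field_simp
      have hr0 : 0 < r := by rw [hr]; positivity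
      have hcr : c = (u - 7 + 6 * r) / 2 := by
        rw [hc, hr]; field_simp; ring
      have hX2 : 1 - 2 * r ≤ X a := by rw [hr]; convert hXa using 2; ring
      have hr6 : r < 1 / 6 := by nlinarith
      have hsq : (1 - 2 * r) ^ 2 ≤ X a ^ 2 := by
        apply pow_le_pow_left₀ (by linarith) hX2
      have e1 : u * X' a ^ 2 ≤ u * (1 - X a ^ 2) := by
        apply mul_le_mul_of_nonneg_left (by linarith) hup.le
      have e2 : u * (1 - 2 * r) ^ 2 ≤ u * X a ^ 2 := mul_le_mul_of_nonneg_left hsq hup.le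
      have e3 : u * (1 - 2 * r) ^ 2 = u - 4 + 4 * r := by
        have : u * (1 - 2 * r) ^ 2 = u - 4 * (r * u) + 4 * r * (r * u) := by ring
        rw [this, hru]; ring
      rw [hcr]
      nlinarith
  have hst : 0 < s + t := by positivity
  have := hconc.2 (show s ∈ Icc (-δ) δ from ⟨by linarith, hsδ⟩)
    (show -t ∈ Icc (-δ) δ from ⟨by linarith, by linarith⟩)
    (show 0 ≤ t / (s + t) by positivity) (show 0 ≤ s / (s + t) by positivity)
    (by rw [← add_div, add_comm t s]; exact div_self hst.ne')
  simp only [smul_eq_mul] at this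
  have e0 : t / (s + t) * s + s / (s + t) * -t = 0 := by ring
  rw [e0] at this
  have h6 : t * G s + s * G (-t) ≤ (s + t) * G 0 := by
    have e : t * G s + s * G (-t) = (s + t) * (t / (s + t) * G s + s / (s + t) * G (-t)) := by
      field_simp
    rw [e]; exact mul_le_mul_of_nonneg_left this hst.le
  have g0 : G 0 = DX τ α := by simp [hG, hXd]
  rw [g0] at h6
  simp only [hG] at h6
  change t * DX τ (X s) - (s + t) * DX τ α + s * DX τ (X (-t)) ≤ _
  nlinarith

lemma msupport_ae (ρ : Measure E3) : ∀ᵐ x ∂ρ, x ∈ msupport ρ := by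
  have h : msupport ρ = ρ.support := by
    rw [Measure.support_eq_forall_isOpen]
    ext x
    exact ⟨fun h U a b => h U b a, fun h U a b => h U b a⟩
  rw [h]
  exact Measure.support_mem_ae

lemma bessel2 {p v q : E3} (hp : ‖p‖ = 1) (hv : ‖v‖ = 1) (hpv : ⟪p, v⟫ = (0 : ℝ)) (hq : ‖q‖ = 1) :
    ⟪p, q⟫ ^ 2 + ⟪v, q⟫ ^ 2 ≤ (1 : ℝ) := by
  have h := real_inner_self_nonneg (x := q - ⟪p, q⟫ • p - ⟪v, q⟫ • v)
  have hvp : ⟪v, p⟫ = (0 : ℝ) := by rw [real_inner_comm]; exact hpv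
  have PP : ⟪p, p⟫ = (1 : ℝ) := by rw [real_inner_self_eq_norm_sq, hp]; norm_num
  have VV : ⟪v, v⟫ = (1 : ℝ) := by rw [real_inner_self_eq_norm_sq, hv]; norm_num
  have QQ : ⟪q, q⟫ = (1 : ℝ) := by rw [real_inner_self_eq_norm_sq, hq]; norm_num
  simp only [inner_sub_left, inner_sub_right, real_inner_smul_left, real_inner_smul_right,
    hpv, hvp, PP, VV, QQ, real_inner_comm p q, real_inner_comm v q] at h
  nlinarith

/-- growth at a light-like boundary point -/
lemma light_growth {τ : ℝ} (hτ : 2 < τ ^ 2) {p v q : E3}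
    (h0 : ⟪p, q⟫ = 1 - 2 / τ ^ 2) (hβ : 0 < ⟪v, q⟫) (a : ℝ) (ha : 0 < a) (ha1 : a ≤ 1)
    (ha2 : a ≤ ⟪v, q⟫ / 2) : τ ^ 2 * ⟪v, q⟫ / 8 * a ≤ Lfun τ (geo p v a) q := by
  rw [Lfun_eq_DX, geo_inner, h0]
  refine le_trans ?_ (le_max_right _ _)
  obtain ⟨u, hu⟩ : ∃ u, u = τ ^ 2 := ⟨_, rfl⟩
  obtain ⟨β, hb⟩ : ∃ β, β = ⟪v, q⟫ := ⟨_, rfl⟩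
  obtain ⟨T, hT⟩ : ∃ T, T = 1 - 2 / τ ^ 2 := ⟨_, rfl⟩
  have hTu : u * (1 - T) = 2 := by 
    have : u ≠ 0 := by rw [hu]; linarith
    rw [hT, ← hu]; field_simp; ring
  have hT0 : 0 < T := by
    rw [hT, ← hu]
    have : 2 / u < 1 := by rw [div_lt_one] <;> linarith
    linarith
  have hT1 : T ≤ 1 := by rw [hT]; have : 0 ≤ 2 / τ ^ 2 := by positivity
                         linarith
  rw [← hT, ← hb]
  rw [← hb] at hβ ha2
  unfold DX
  rw [← hu] at hτ ⊢
  set X := Real.cos a * T + Real.sin a * β with hX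
  have c1 := Real.one_sub_sq_div_two_le_cos (x := a)
  have s1 := Real.sin_gt_sub_cube ha
  have a3 : 0 < a ^ 3 := by positivity
  have k1 : (1 - a ^ 2 / 2) * T ≤ Real.cos a * T := mul_le_mul_of_nonneg_right c1 hT0.le
  have k2 : (a - a ^ 3 / 4) * β ≤ Real.sin a * β := mul_le_mul_of_nonneg_right (by linarith) hβ.le
  have k3 : a ^ 2 * T ≤ a ^ 2 := by nlinarith [sq_nonneg a]
  have k4 : a ^ 2 ≤ a * (β / 2) := by nlinarith
  have k5 : a ^ 3 * β ≤ a * β := by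
    have : a ^ 3 ≤ a := by nlinarith [sq_nonneg a, mul_nonneg ha.le (sub_nonneg.2 ha1)]
    exact mul_le_mul_of_nonneg_right this hβ.le
  have hXT : a * β / 2 ≤ X - T := by rw [hX]; linarith
  have hab : 0 < a * β := by positivity
  have e : 2 - u * (1 - X) = u * (X - T) := by linarith [hTu]
  rw [e]
  have h1 : 1 ≤ 1 + X := by linarith
  have h2 : u * (a * β / 2) ≤ u * (X - T) := mul_le_mul_of_nonneg_left hXT (by linarith)
  have h3 : 0 ≤ u * (X - T) := le_trans (by positivity) h2
  nlinarith

lemma light_contra {τ : ℝ} (hτ : 2 < τ ^ 2) {p v q : E3}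
    (h0 : ⟪p, q⟫ = 1 - 2 / τ ^ 2) (hβ : 0 < ⟪v, q⟫) (C2 : ℝ) (hC2 : 0 < C2) (s t r : ℝ)
    (hs : 0 < s) (ht : 0 < t)
    (hs1 : s ≤ 1) (hs2 : s ≤ ⟪v, q⟫ / 2) (hst : C2 * (s + t) < τ ^ 2 * ⟪v, q⟫ / 8)
    (hr : 0 ≤ r)
    (hK : t * Lfun τ (geo p v s) q + r ≤ C2 * (s * t * (s + t))) : False := by
  have h := light_growth hτ h0 hβ s hs hs1 hs2
  have h1 := mul_le_mul_of_nonneg_left h ht.le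
  have h2 : (s * t) * (C2 * (s + t)) < (s * t) * (τ ^ 2 * ⟪v, q⟫ / 8) :=
    mul_lt_mul_of_pos_left hst (by positivity)
  nlinarith

lemma Lfun_nonneg (τ : ℝ) (x y : E3) : 0 ≤ Lfun τ x y := le_max_left _ _

lemma Lfun_zero {τ : ℝ} (hτ : 0 < τ) {x y : E3} (hx : ‖x‖ = 1) (hy : ‖y‖ = 1)
    (h : ⟪x, y⟫ ≤ 1 - 2 / τ ^ 2) : Lfun τ x y = 0 :=
  max_eq_left (DX_nonpos hτ (abs_le.1 (abs_inner_le_one hx hy)).1 h)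

lemma Lfun_DX {τ : ℝ} (hτ : 0 < τ) {x y : E3} (hx : ‖x‖ = 1) (hy : ‖y‖ = 1)
    (h : 1 - 2 / τ ^ 2 ≤ ⟪x, y⟫) : Lfun τ x y = DX τ ⟪x, y⟫ :=
  max_eq_right (DX_nonneg hτ (abs_le.1 (abs_inner_le_one hx hy)).1 h)

open Filter Topology in
lemma ev_le (τ : ℝ) (hτ : Real.sqrt 6 < τ) (c : ℝ)
    (hc : ∀ α β : ℝ, α ^ 2 + β ^ 2 ≤ 1 →
    ∀ δ > 0, (∀ a ∈ Icc (-δ) δ, 1 - 2 / τ ^ 2 ≤ Real.cos a * α + Real.sin a * β) →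
    ∀ s t : ℝ, 0 < s → 0 < t → s ≤ δ → t ≤ δ →
    t * DX τ (Real.cos s * α + Real.sin s * β) - (s + t) * DX τ α +
      s * DX τ (Real.cos (-t) * α + Real.sin (-t) * β) ≤ - c * (s * t * (s + t)))
    (p v q : E3) (hp : ‖p‖ = 1) (hv : ‖v‖ = 1) (hpv : ⟪p, v⟫ = (0 : ℝ)) (hq : ‖q‖ = 1)
    (s t : ℕ → ℝ) (hs : ∀ n, 0 < s n) (ht : ∀ n, 0 < t n) (ls : Tendsto s atTop (𝓝 0))
    (lt : Tendsto t atTop (𝓝 0)) (C2 : ℝ) (hC2 : 0 < C2)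
    (hK : ∀ n, |t n * Lfun τ (geo p v (s n)) q - (s n + t n) * Lfun τ p q +
      s n * Lfun τ (geo p v (-t n)) q| ≤ C2 * (s n * t n * (s n + t n))) :
    ∀ᶠ n in atTop, t n * Lfun τ (geo p v (s n)) q - (s n + t n) * Lfun τ p q +
      s n * Lfun τ (geo p v (-t n)) q ≤
      (if 1 - 2 / τ ^ 2 < ⟪p, q⟫ then -c else 0) * (s n * t n * (s n + t n)) := by
  have hτ0 : 0 < τ := lt_of_le_of_lt (Real.sqrt_nonneg _) hτ
  have hu : 6 < τ ^ 2 := by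
    have := (Real.sqrt_lt (by norm_num) hτ0.le).1 hτ; exact this
  have lt' : Tendsto (fun n => - t n) atTop (𝓝 0) := by simpa using lt.neg
  have hcont : Continuous (fun a => ⟪geo p v a, q⟫) := by
    unfold geo; fun_prop
  have l0 : Tendsto (fun a => ⟪geo p v a, q⟫) (𝓝 0) (𝓝 ⟪p, q⟫) := by
    have := hcont.tendsto 0; rwa [geo_zero] at this
  have gn := geo_norm hp hv hpv
  rcases lt_trichotomy ⟪p, q⟫ (1 - 2 / τ ^ 2) with h | h | h
  · rw [if_neg (by linarith)]
    filter_upwards [(l0.comp ls).eventually_lt_const h, (l0.comp lt').eventually_lt_const h]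
      with n h1 h2
    rw [Lfun_zero hτ0 hp hq h.le, Lfun_zero hτ0 (gn _) hq (le_of_lt h1),
      Lfun_zero hτ0 (gn _) hq (le_of_lt h2)]
    simp
  · rw [if_neg (by linarith)]
    have e0 := Lfun_zero hτ0 hp hq h.le
    have lst : Tendsto (fun n => C2 * (s n + t n)) atTop (𝓝 0) := by
      simpa using (ls.add lt).const_mul C2
    rcases lt_trichotomy ⟪v, q⟫ 0 with hb | hb | hb
    · have hb' : 0 < ⟪-v, q⟫ := by rw [inner_neg_left]; linarith
      filter_upwards [lt.eventually_lt_const one_pos, lt.eventually_lt_const (half_pos hb'),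
        lst.eventually_lt_const (show 0 < τ ^ 2 * ⟪-v, q⟫ / 8 by positivity)] with n h1 h2 h3
      exfalso
      have := (le_abs_self _).trans (hK n)
      rw [e0, geo_neg] at this
      refine light_contra (by linarith) h hb' C2 hC2 (t n) (s n)
        (t n * Lfun τ (geo p v (s n)) q) (ht n) (hs n) h1.le h2.le (by rwa [add_comm])
        (mul_nonneg (ht n).le (Lfun_nonneg _ _ _)) ?_
      linarith
    · filter_upwards with n
      have ht0 : 0 < 1 - 2 / τ ^ 2 := by
        have : 2 / τ ^ 2 < 1 := by rw [div_lt_one] <;> linarith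
        linarith
      have hz : ∀ a, Lfun τ (geo p v a) q = 0 := by
        intro a
        apply Lfun_zero hτ0 (gn _) hq
        rw [geo_inner, hb, h, mul_zero, add_zero]
        nlinarith [Real.cos_le_one a]
      rw [hz, hz, e0]; simp
    · filter_upwards [ls.eventually_lt_const one_pos, ls.eventually_lt_const (half_pos hb),
        lst.eventually_lt_const (show 0 < τ ^ 2 * ⟪v, q⟫ / 8 by positivity)] with n h1 h2 h3
      exfalso
      have := (le_abs_self _).trans (hK n)
      rw [e0] at this
      refine light_contra (by linarith) h hb C2 hC2 (s n) (t n)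
        (s n * Lfun τ (geo p v (-t n)) q) (hs n) (ht n) h1.le h2.le h3
        (mul_nonneg (hs n).le (Lfun_nonneg _ _ _)) ?_
      linarith
  · rw [if_pos h]
    obtain ⟨δ, hδ, hδ'⟩ := Metric.nhds_basis_closedBall.eventually_iff.1 (l0.eventually_const_lt h)
    have hI : ∀ a ∈ Icc (-δ) δ, 1 - 2 / τ ^ 2 ≤ ⟪geo p v a, q⟫ := by
      intro a ha
      refine (hδ' (x := a) ?_).le
      rw [Metric.mem_closedBall, Real.dist_eq, sub_zero, abs_le]; exact ha
    filter_upwards [ls.eventually_lt_const hδ, lt.eventually_lt_const hδ] with n h1 h2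
    have hsn := hs n
    have htn := ht n
    rw [Lfun_DX hτ0 hp hq h.le, Lfun_DX hτ0 (gn _) hq (hI _ ⟨by linarith, h1.le⟩),
      Lfun_DX hτ0 (gn _) hq (hI (-t n) ⟨by linarith, by linarith⟩), geo_inner, geo_inner]
    exact hc _ _ (bessel2 hp hv hpv hq) δ hδ (fun a ha => by rw [← geo_inner]; exact hI a ha) _ _
      hsn htn h1.le h2.le

open Filter Topology in
lemma two_sided (τ : ℝ) (hτ : Real.sqrt 6 < τ) (ρ : Measure E3) (hm : IsMinimizer τ ρ) (p v : E3)
    (hpM : p ∈ msupport ρ) (hv : ‖v‖ = 1) (hpv : ⟪p, v⟫ = (0 : ℝ)) (C : ℝ) (hC : 0 ≤ C)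
    (h1 : ∀ ε > 0, ∃ x ∈ msupport ρ, ∃ s, 0 < s ∧ s < ε ∧ ‖x - p - s • v‖ ≤ C * s ^ 2)
    (h2 : ∀ ε > 0, ∃ y ∈ msupport ρ, ∃ t, 0 < t ∧ t < ε ∧ ‖y - p + t • v‖ ≤ C * t ^ 2) :
    False := by
  have hτ0 : 0 < τ := lt_of_le_of_lt (Real.sqrt_nonneg _) hτ
  obtain ⟨c, hc0, hc⟩ := concave_bound τ hτ
  set ε : ℕ → ℝ := fun n => min (1 / ((n : ℝ) + 1)) (min (1 / (C + 1)) (1 / (2 * τ))) with hε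
  have hεp : ∀ n, 0 < ε n := fun n => by simp only [hε]; positivity
  have lε : Tendsto ε atTop (𝓝 0) :=
    squeeze_zero (fun n => (hεp n).le) (fun n => min_le_left _ _)
      tendsto_one_div_add_atTop_nhds_zero_nat
  choose x hxM s hs hsε hx using fun n => h1 (ε n) (hεp n)
  choose y hyM t ht htε hy using fun n => h2 (ε n) (hεp n)
  have ls : Tendsto s atTop (𝓝 0) := squeeze_zero (fun n => (hs n).le) (fun n => (hsε n).le) lε
  have lt : Tendsto t atTop (𝓝 0) := squeeze_zero (fun n => (ht n).le) (fun n => (htε n).le) lε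
  have b1 : ∀ n a, a < ε n → a ≤ 1 := fun n a ha => by
    refine ha.le.trans ((min_le_left _ _).trans ?_)
    rw [div_le_one (by positivity)]; simp
  have b2 : ∀ n a, 0 < a → a < ε n → C * a ≤ 1 := fun n a ha0 ha => by
    have := ha.le.trans ((min_le_right _ _).trans (min_le_left _ _))
    rw [le_div_iff₀ (by positivity)] at this
    nlinarith
  have b3 : ∀ n a, a < ε n → 2 * a ≤ 1 / τ := fun n a ha => by
    have := ha.le.trans ((min_le_right _ _).trans (min_le_right _ _))
    rw [le_div_iff₀ (by positivity)] at this ⊢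
    linarith
  set C2 := (1 + τ) * (2 * C + 4) + (1 + τ ^ 2) * (C + 1) with hC2
  have hC2p : 0 < C2 := by positivity
  set K : ℕ → E3 → ℝ := fun n q => t n * Lfun τ (geo p v (s n)) q - (s n + t n) * Lfun τ p q +
      s n * Lfun τ (geo p v (-t n)) q with hKdef
  set F : ℕ → ℝ := fun n => s n * t n * (s n + t n) with hF
  have hFp : ∀ n, 0 < F n := fun n => by
    have := hs n
    have := ht n
    simp only [hF]; positivity
  have hK : ∀ n, ∀ q ∈ msupport ρ, |K n q| ≤ C2 * F n := fun n q hq =>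
    Kgeo_bound τ hτ0 ρ hm p v (x n) (y n) q hpM (hxM n) (hyM n) hq hv hpv C (s n) (t n) hC (hs n)
      (ht n) (b1 n _ (hsε n)) (b1 n _ (htε n)) (b2 n _ (hs n) (hsε n)) (b2 n _ (ht n) (htε n))
      (b3 n _ (hsε n)) (b3 n _ (htε n)) (hx n) (hy n)
  have hsub := msupport_sub ρ hm.2.2.1
  have np := norm_of_sphere (hsub hpM)
  have hge := ell_ge τ ρ hm
  have heq := ell_eq τ ρ hm p hpM
  have hae := msupport_ae ρ
  obtain ⟨hprob, hr, h0, -⟩ := hm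
  have hKc : ∀ n, Continuous (K n) := fun n =>
    (((continuous_Lfun_right τ _).const_mul _).sub ((continuous_Lfun_right τ _).const_mul _)).add
      ((continuous_Lfun_right τ _).const_mul _)
  have hKint : ∀ n, 0 ≤ ∫ q, K n q ∂ρ := by
    intro n
    have i1 : ∀ z, Integrable (fun q => Lfun τ z q) ρ := fun z =>
      intg_of_cont ρ h0 (continuous_Lfun_right τ z)
    have e : ∫ q, K n q ∂ρ = t n * ell τ ρ (geo p v (s n)) - (s n + t n) * ell τ ρ p +
        s n * ell τ ρ (geo p v (-t n)) := by
      simp only [hKdef]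
      have j1 : Integrable (fun q => t n * Lfun τ (geo p v (s n)) q - (s n + t n) * Lfun τ p q) ρ :=
        ((i1 _).const_mul _).sub ((i1 _).const_mul _)
      rw [integral_add j1 ((i1 _).const_mul _),
        integral_sub ((i1 _).const_mul _) ((i1 _).const_mul _), integral_const_mul,
        integral_const_mul, integral_const_mul]
      rfl
    rw [e, heq]
    have g : ∀ a, geo p v a ∈ Sphere2 := fun a => by
      simp [Sphere2, geo_norm np hv hpv a]
    have j1 := mul_le_mul_of_nonneg_left (hge _ (g (s n))) (ht n).le
    have j2 := mul_le_mul_of_nonneg_left (hge _ (g (-t n))) (hs n).le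
    linarith
  set χ : E3 → ℝ := fun q => if 1 - 2 / τ ^ 2 < ⟪p, q⟫ then -c else 0 with hχ
  have hop : IsOpen {q : E3 | 1 - 2 / τ ^ 2 < ⟪p, q⟫} :=
    isOpen_lt continuous_const (by fun_prop)
  have hχm : Measurable χ := Measurable.ite hop.measurableSet measurable_const measurable_const
  have hχb : ∀ q, |χ q| ≤ c := fun q => by
    simp only [hχ]; split_ifs
    · rw [abs_neg, abs_of_pos hc0]
    · simpa using hc0.le
  have hχint : ∫ q, χ q ∂ρ < 0 := by
    have e : χ = Set.indicator {q : E3 | 1 - 2 / τ ^ 2 < ⟪p, q⟫} (fun _ => -c) := by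
      funext q; simp [hχ, Set.indicator]
    rw [e, integral_indicator hop.measurableSet, setIntegral_const, smul_eq_mul]
    have hpos : 0 < ρ {q : E3 | 1 - 2 / τ ^ 2 < ⟪p, q⟫} := by
      apply hpM _ hop
      simp only [mem_setOf_eq, real_inner_self_eq_norm_sq, np]
      have : 0 < 2 / τ ^ 2 := by positivity
      linarith
    have : 0 < ρ.real {q : E3 | 1 - 2 / τ ^ 2 < ⟪p, q⟫} :=
      ENNReal.toReal_pos hpos.ne' (measure_ne_top _ _)
    nlinarith
  have hlim : Tendsto (fun n => ∫ q, max (K n q / F n) (χ q) ∂ρ) atTop (𝓝 (∫ q, χ q ∂ρ)) := by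
    refine tendsto_integral_of_dominated_convergence (fun _ => C2 + c) ?_ (integrable_const _) ?_ ?_
    · exact fun n => (((hKc n).div_const _).measurable.max hχm).aestronglyMeasurable
    · intro n
      filter_upwards [hae] with q hq
      rw [Real.norm_eq_abs]
      have k1 : |K n q / F n| ≤ C2 := by
        rw [abs_div, abs_of_pos (hFp n), div_le_iff₀ (hFp n)]; exact hK n q hq
      refine abs_max_le_max_abs_abs.trans (max_le ?_ ?_)
      · linarith
      · linarith [hχb q]
    · filter_upwards [hae] with q hq
      have := ev_le τ hτ c hc p v q np hv hpv (norm_of_sphere (hsub hq)) s t hs ht ls lt C2 hC2p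
        (fun n => hK n q hq)
      refine tendsto_const_nhds.congr' ?_
      filter_upwards [this] with n hn
      symm
      apply max_eq_right
      rw [div_le_iff₀ (hFp n)]
      exact hn
  have hge0 : ∀ n, 0 ≤ ∫ q, max (K n q / F n) (χ q) ∂ρ := by
    intro n
    have i1 : Integrable (fun q => K n q / F n) ρ := intg_of_cont ρ h0 ((hKc n).div_const _)
    have i2 : Integrable χ ρ := Integrable.of_bound hχm.aestronglyMeasurable c
      (Eventually.of_forall hχb)
    have : ∫ q, K n q / F n ∂ρ ≤ ∫ q, max (K n q / F n) (χ q) ∂ρ :=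
      integral_mono i1 (i1.sup i2) (fun q => le_max_left _ _)
    refine le_trans ?_ this
    rw [integral_div]
    exact div_nonneg (hKint n) (hFp n).le
  exact absurd (ge_of_tendsto' hlim hge0) (not_le.2 hχint)

noncomputable def Qf (q : E3 × (E3 →L[ℝ] E3)) (x : E3) : ℝ := ⟪q.1, x⟫ + ⟪x, q.2 x⟫

lemma frame (p u : E3) (hp : ‖p‖ = 1) (hu : ‖u‖ = 1) (hpu : ⟪p, u⟫ = (0 : ℝ)) :
    ∃ e : OrthonormalBasis (Fin 3) ℝ E3, e 0 = p ∧ e 1 = u := by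
  have ho : Orthonormal ℝ (Set.domRestrict ({0, 1} : Set (Fin 3)) (![p, u, 0] : Fin 3 → E3)) := by
    have hup : ⟪u, p⟫ = (0 : ℝ) := by rw [real_inner_comm]; exact hpu
    constructor
    · rintro ⟨i, hi⟩
      rcases hi with rfl | rfl
      · exact hp
      · exact hu
    · rintro ⟨i, hi⟩ ⟨j, hj⟩ hij
      rcases hi with rfl | rfl <;> rcases hj with rfl | rfl
      · exact absurd rfl hij
      · exact hpu
      · exact hup
      · exact absurd rfl hij
  obtain ⟨e, he⟩ := Orthonormal.exists_orthonormalBasis_extension_of_card_eq (by simp) ho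
  exact ⟨e, by simpa using he 0 (by simp), by simpa using he 1 (by simp)⟩

lemma onesided (τ : ℝ) (hτ : Real.sqrt 6 < τ) (ρ : Measure E3) (hm : IsMinimizer τ ρ)
    (A : Set E3) (hA : A ⊆ msupport ρ) (p : E3) (hp : p ∈ A) (q : E3 × (E3 →L[ℝ] E3))
    (hq : ∀ x ∈ A, Qf q x = 0) (w : E3) (hpw : ⟪p, w⟫ = (0 : ℝ))
    (hw : ⟪q.1, w⟫ + ⟪p, q.2 w⟫ + ⟪w, q.2 p⟫ ≠ 0) :
    ∃ v : E3, ∃ r > 0, ∀ x ∈ A, ‖x - p‖ < r → x ≠ p → ⟪x - p, v⟫ ≤ - (‖x - p‖ / 2) := by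
  have hsub := msupport_sub ρ hm.2.2.1
  have np := norm_of_sphere (hsub (hA hp))
  set g : E3 := q.1 + q.2 p + (ContinuousLinearMap.adjoint q.2) p with hg
  have hgi : ∀ z : E3, ⟪g, z⟫ = ⟪q.1, z⟫ + ⟪p, q.2 z⟫ + ⟪z, q.2 p⟫ := by
    intro z
    rw [hg, inner_add_left, inner_add_left, ContinuousLinearMap.adjoint_inner_left,
      real_inner_comm z (q.2 p)]
    ring
  rw [← hgi] at hw
  set gT := g - ⟪g, p⟫ • p with hgT
  have hgTw : ⟪gT, w⟫ = ⟪g, w⟫ := by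
    rw [hgT, inner_sub_left, real_inner_smul_left, hpw]; ring
  have hgT0 : gT ≠ 0 := by
    intro h; rw [h, inner_zero_left] at hgTw; exact hw hgTw.symm
  have hn : 0 < ‖gT‖ := norm_pos_iff.2 hgT0
  have hpp : ⟪p, p⟫ = (1 : ℝ) := by rw [real_inner_self_eq_norm_sq, np]; norm_num
  have hpgT : ⟪p, gT⟫ = (0 : ℝ) := by
    rw [hgT, inner_sub_right, real_inner_smul_right, hpp, real_inner_comm]; ring
  obtain ⟨e, e0, e1⟩ := frame p (‖gT‖⁻¹ • gT) np (by
    rw [norm_smul, norm_inv, norm_norm, inv_mul_cancel₀ hn.ne']) (by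
    rw [real_inner_smul_right, hpgT, mul_zero])
  set v := e 2 with hv
  set u := ‖gT‖⁻¹ • gT with hu
  have nv : ‖v‖ = 1 := e.orthonormal.1 2
  have nu : ‖u‖ = 1 := by rw [← e1]; exact e.orthonormal.1 1
  have hpv : ⟪p, v⟫ = (0 : ℝ) := by
    rw [← e0]; exact e.orthonormal.2 (by decide)
  have hgu : g = ‖gT‖ • u + ⟪g, p⟫ • p := by
    rw [hu, smul_smul, mul_inv_cancel₀ hn.ne', one_smul, hgT]; abel
  clear_value u
  set C0 := (‖q.2‖ + ‖g‖ / 2) / ‖gT‖ with hC0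
  have hC0n : 0 ≤ C0 := by positivity
  set Cc := C0 + 1 / 2 with hCc
  have hCcp : 0 < Cc := by positivity
  -- basic estimates
  have est : ∀ x ∈ A, ‖x - p - ⟪x - p, v⟫ • v‖ ≤ Cc * ‖x - p‖ ^ 2 := by
    intro x hx
    have nx := norm_of_sphere (hsub (hA hx))
    set h := x - p with hh
    have hxp : x = p + h := by rw [hh]; abel
    have hph : ⟪p, h⟫ = -(‖h‖ ^ 2 / 2) := by
      have h1 := norm_add_sq_real p h
      rw [← hxp, nx, np] at h1
      linarith
    have hgh : ⟪g, h⟫ = - ⟪h, q.2 h⟫ := by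
      have h1 := hq x hx
      have h2 := hq p hp
      unfold Qf at h1 h2
      rw [hxp, map_add, inner_add_left, inner_add_right, inner_add_right, inner_add_right] at h1
      rw [hgi]; linarith
    have hAh : |⟪h, q.2 h⟫| ≤ ‖q.2‖ * ‖h‖ ^ 2 := by
      refine (abs_real_inner_le_norm _ _).trans ?_
      calc ‖h‖ * ‖q.2 h‖ ≤ ‖h‖ * (‖q.2‖ * ‖h‖) := by gcongr; exact q.2.le_opNorm h
        _ = _ := by ring
    have huh : |⟪u, h⟫| ≤ C0 * ‖h‖ ^ 2 := by
      have h3 : ⟪g, h⟫ = ‖gT‖ * ⟪u, h⟫ + ⟪g, p⟫ * ⟪p, h⟫ := by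
        have h9 := congrArg (fun z => ⟪z, h⟫) hgu
        simp only [inner_add_left] at h9
        rw [real_inner_smul_left, real_inner_smul_left] at h9
        exact h9
      have h4 : ‖gT‖ * |⟪u, h⟫| ≤ (‖q.2‖ + ‖g‖ / 2) * ‖h‖ ^ 2 := by
        have h8 : ‖gT‖ * |⟪u, h⟫| = |‖gT‖ * ⟪u, h⟫| := by rw [abs_mul, abs_of_pos hn]
        rw [h8]
        have h5 : ‖gT‖ * ⟪u, h⟫ = - ⟪h, q.2 h⟫ + ⟪g, p⟫ * (‖h‖ ^ 2 / 2) := by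
          rw [hph, hgh] at h3; linarith
        rw [h5]
        refine (abs_add_le _ _).trans ?_
        rw [abs_neg, abs_mul, abs_of_nonneg (by positivity : 0 ≤ ‖h‖ ^ 2 / 2)]
        have h6 : |⟪g, p⟫| ≤ ‖g‖ := by
          have := abs_real_inner_le_norm g p
          rwa [np, mul_one] at this
        have h7 : |⟪g, p⟫| * (‖h‖ ^ 2 / 2) ≤ ‖g‖ * (‖h‖ ^ 2 / 2) := by gcongr
        linarith
      rw [hC0, div_mul_eq_mul_div, le_div_iff₀ hn, mul_comm]; exact h4
    have hsum := e.sum_repr' h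
    rw [Fin.sum_univ_three, e0, e1, ← hv] at hsum
    have e3 : h - ⟪h, v⟫ • v = ⟪p, h⟫ • p + ⟪u, h⟫ • u := by
      rw [sub_eq_iff_eq_add, real_inner_comm v h]; exact hsum.symm
    rw [e3]
    refine (norm_add_le _ _).trans ?_
    rw [norm_smul, norm_smul, np, nu, mul_one, mul_one, Real.norm_eq_abs, Real.norm_eq_abs, hph,
      abs_neg, abs_of_nonneg (by positivity : 0 ≤ ‖h‖ ^ 2 / 2), hCc]
    linarith
  set r0 := 1 / (2 * Cc) with hr0
  have hr0p : 0 < r0 := by positivity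
  have est2 : ∀ x ∈ A, ‖x - p‖ < r0 → ‖x - p‖ / 2 ≤ |⟪x - p, v⟫| ∧
      ‖x - p - ⟪x - p, v⟫ • v‖ ≤ 4 * Cc * ⟪x - p, v⟫ ^ 2 := by
    intro x hx hr
    have h1 := est x hx
    have h2 : ‖x - p‖ ≤ ‖x - p - ⟪x - p, v⟫ • v‖ + |⟪x - p, v⟫| := by
      have := norm_add_le (x - p - ⟪x - p, v⟫ • v) (⟪x - p, v⟫ • v)
      rwa [sub_add_cancel, norm_smul, nv, mul_one, Real.norm_eq_abs] at this
    have h3 : Cc * ‖x - p‖ ≤ 1 / 2 := by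
      rw [hr0, lt_div_iff₀ (by positivity)] at hr; linarith
    have h4 : Cc * ‖x - p‖ ^ 2 ≤ ‖x - p‖ / 2 := by
      have := mul_le_mul_of_nonneg_right h3 (norm_nonneg (x - p))
      nlinarith
    have h5 : ‖x - p‖ / 2 ≤ |⟪x - p, v⟫| := by linarith
    refine ⟨h5, h1.trans ?_⟩
    have h6 : (‖x - p‖ / 2) ^ 2 ≤ |⟪x - p, v⟫| ^ 2 := by gcongr
    rw [sq_abs] at h6
    nlinarith
  by_contra hcon
  push Not at hcon
  have le : ∀ x, |⟪x - p, v⟫| ≤ ‖x - p‖ := fun x => by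
    have := abs_real_inner_le_norm (x - p) v
    rwa [nv, mul_one] at this
  refine two_sided τ hτ ρ hm p v (hA hp) nv hpv (4 * Cc) (by positivity) ?_ ?_
  · intro ε hε
    obtain ⟨x, hx, hr, hne, hxv⟩ := hcon v (min ε r0) (by positivity)
    obtain ⟨a1, a2⟩ := est2 x hx (hr.trans_le (min_le_right _ _))
    have hpos : 0 < ‖x - p‖ := norm_pos_iff.2 (sub_ne_zero.2 hne)
    have a3 : 0 < ⟪x - p, v⟫ := by
      by_contra hc
      rw [abs_of_nonpos (not_lt.1 hc)] at a1
      linarith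
    refine ⟨x, hA hx, _, a3, ?_, a2⟩
    exact lt_of_le_of_lt ((le_abs_self _).trans (le x)) (hr.trans_le (min_le_left _ _))
  · intro ε hε
    obtain ⟨x, hx, hr, hne, hxv⟩ := hcon (-v) (min ε r0) (by positivity)
    rw [inner_neg_right] at hxv
    obtain ⟨a1, a2⟩ := est2 x hx (hr.trans_le (min_le_right _ _))
    have hpos : 0 < ‖x - p‖ := norm_pos_iff.2 (sub_ne_zero.2 hne)
    have a3 : 0 < - ⟪x - p, v⟫ := by
      by_contra hc
      rw [abs_of_nonneg (by linarith)] at a1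
      linarith
    refine ⟨x, hA hx, _, a3, ?_, ?_⟩
    · exact lt_of_le_of_lt ((neg_le_abs _).trans (le x)) (hr.trans_le (min_le_left _ _))
    · rw [neg_smul, neg_sq, ← sub_eq_add_neg]; exact a2

lemma countable_of_onesided (A S : Set E3) (hS : S ⊆ A)
    (h : ∀ p ∈ S, ∃ v : E3, ∃ r > 0, ∀ x ∈ A, ‖x - p‖ < r → x ≠ p →
      ⟪x - p, v⟫ ≤ - (‖x - p‖ / 2)) : S.Countable := by
  let d := TopologicalSpace.denseSeq E3
  let N : ℕ × ℕ → Set E3 := fun k => {p | p ∈ S ∧ ∀ x ∈ A, ‖x - p‖ < 1 / ((k.1 : ℝ) + 1) → x ≠ p →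
    ⟪x - p, d k.2⟫ < 0}
  have hN : ∀ k, (N k).Countable := by
    intro k
    have hk : 0 < 1 / ((k.1 : ℝ) + 1) := by positivity
    refine Set.PairwiseDisjoint.countable_of_isOpen
      (s := fun p => Metric.ball p (1 / ((k.1 : ℝ) + 1) / 2)) ?_ (fun p _ => Metric.isOpen_ball)
      (fun p _ => ⟨p, Metric.mem_ball_self (by positivity)⟩)
    intro p hp y hy hne
    refine Metric.ball_disjoint_ball ?_
    rw [add_halves]
    by_contra hlt
    push Not at hlt
    rw [dist_eq_norm] at hlt
    have h1 := hp.2 y (hS hy.1) (by rwa [norm_sub_rev]) hne.symm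
    have h2 := hy.2 p (hS hp.1) hlt hne
    rw [← neg_sub, inner_neg_left] at h2
    linarith
  refine (Set.countable_iUnion hN).mono ?_
  intro p hp
  obtain ⟨v, r, hr, hv⟩ := h p hp
  obtain ⟨n, hn⟩ := exists_nat_one_div_lt hr
  obtain ⟨m, hm⟩ := (TopologicalSpace.denseRange_denseSeq E3).exists_dist_lt v
    (show (0 : ℝ) < 1 / 2 by norm_num)
  refine mem_iUnion.2 ⟨(n, m), hp, fun x hx hxr hne => ?_⟩
  have h1 := hv x hx (hxr.trans hn) hne
  have h2 : ⟪x - p, d m⟫ = ⟪x - p, v⟫ + ⟪x - p, d m - v⟫ := by rw [inner_sub_right]; ring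
  have h3 := (le_abs_self _).trans (abs_real_inner_le_norm (x - p) (d m - v))
  have hpos : 0 < ‖x - p‖ := norm_pos_iff.2 (sub_ne_zero.2 hne)
  have h4 : ‖d m - v‖ < 1 / 2 := by rw [← dist_eq_norm, dist_comm]; exact hm
  change ⟪x - p, d m⟫ < 0
  rw [h2]
  nlinarith

def Skew (J : E3 →L[ℝ] E3) : Prop := ∀ x y : E3, ⟪J x, y⟫ = - ⟪x, J y⟫

noncomputable def Rr (J : E3 →L[ℝ] E3) (q : E3 × (E3 →L[ℝ] E3)) : E3 × (E3 →L[ℝ] E3) :=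
  (- J q.1, q.2.comp J - J.comp q.2)

def der (F : Set (E3 × (E3 →L[ℝ] E3))) : Set (E3 × (E3 →L[ℝ] E3)) :=
  {q' | ∃ q ∈ F, ∃ J, Skew J ∧ q' = Rr J q}

lemma Qf_Rr (J : E3 →L[ℝ] E3) (hJ : Skew J) (q : E3 × (E3 →L[ℝ] E3)) (x : E3) :
    Qf (Rr J q) x = ⟪q.1, J x⟫ + ⟪x, q.2 (J x)⟫ + ⟪J x, q.2 x⟫ := by
  simp only [Qf, Rr, inner_neg_left, ContinuousLinearMap.sub_apply, ContinuousLinearMap.comp_apply,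
    inner_sub_right]
  rw [hJ q.1 x, hJ x (q.2 x)]; ring

lemma step (τ : ℝ) (hτ : Real.sqrt 6 < τ) (ρ : Measure E3) (hm : IsMinimizer τ ρ)
    (A : Set E3) (hA : A ⊆ msupport ρ) (F : Set (E3 × (E3 →L[ℝ] E3)))
    (hF : ∀ q ∈ F, ∀ x ∈ A, Qf q x = 0)
    (h : {x | x ∈ A ∧ ∀ q ∈ der F, Qf q x = 0}.Countable) : A.Countable := by
  have h2 : {x | x ∈ A ∧ ¬ ∀ q ∈ der F, Qf q x = 0}.Countable := by
    refine countable_of_onesided A _ (fun x hx => hx.1) ?_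
    rintro p ⟨hp, hn⟩
    push Not at hn
    obtain ⟨q', ⟨q, hq, J, hJ, rfl⟩, hne⟩ := hn
    rw [Qf_Rr J hJ] at hne
    refine onesided τ hτ ρ hm A hA p hp q (hF q hq) (J p) ?_ hne
    have := hJ p p
    rw [real_inner_comm] at this
    linarith
  refine (h.union h2).mono fun x hx => ?_
  by_cases hc : ∀ q ∈ der F, Qf q x = 0
  · exact Or.inl ⟨hx, hc⟩
  · exact Or.inr ⟨hx, hc⟩

noncomputable def Jpu (p u : E3) : E3 →L[ℝ] E3 :=
  (innerSL ℝ p).smulRight u - (innerSL ℝ u).smulRight p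

lemma Jpu_apply (p u y : E3) : Jpu p u y = ⟪p, y⟫ • u - ⟪u, y⟫ • p := by
  simp [Jpu]

lemma Jpu_skew (p u : E3) : Skew (Jpu p u) := by
  intro x y
  simp only [Jpu_apply, inner_sub_left, inner_sub_right, real_inner_smul_left,
    real_inner_smul_right]
  rw [real_inner_comm x u, real_inner_comm x p]; ring

lemma jet (p u : E3) (hp : ⟪p, p⟫ = (1 : ℝ)) (hu : ⟪u, u⟫ = (1 : ℝ)) (hpu : ⟪p, u⟫ = (0 : ℝ))
    (q : E3 × (E3 →L[ℝ] E3))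
    (h0 : Qf q p = 0) (h1 : Qf (Rr (Jpu p u) q) p = 0)
    (h2 : Qf (Rr (Jpu p u) (Rr (Jpu p u) q)) p = 0)
    (h3 : Qf (Rr (Jpu p u) (Rr (Jpu p u) (Rr (Jpu p u) q))) p = 0)
    (h4 : Qf (Rr (Jpu p u) (Rr (Jpu p u) (Rr (Jpu p u) (Rr (Jpu p u) q)))) p = 0) :
    ⟪p, q.2 p⟫ = (0 : ℝ) ∧ ⟪u, q.2 u⟫ = (0 : ℝ) := by
  have hup : ⟪u, p⟫ = (0 : ℝ) := by rw [real_inner_comm]; exact hpu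
  set J := Jpu p u with hJd
  have hJ : Skew J := Jpu_skew p u
  have jp : J p = u := by rw [hJd, Jpu_apply, hp, hup]; simp
  have ju : J u = -p := by rw [hJd, Jpu_apply, hpu, hu]; simp
  have J' : ∀ x y : E3, ⟪x, J y⟫ = - ⟪J x, y⟫ := fun x y => by rw [hJ x y]; ring
  simp only [Qf, Rr, ContinuousLinearMap.sub_apply, ContinuousLinearMap.comp_apply, jp, ju,
    inner_neg_left, inner_neg_right, inner_sub_right, map_neg, map_sub, J', hJ _ p, hJ _ u] 
    at h0 h1 h2 h3 h4
  constructor <;> linarith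

lemma trace_zero (p : E3) (np : ‖p‖ = 1) (q : E3 × (E3 →L[ℝ] E3)) (h0 : Qf q p = 0)
    (h1 : ∀ q' ∈ der {q}, Qf q' p = 0) (h2 : ∀ q' ∈ der (der {q}), Qf q' p = 0)
    (h3 : ∀ q' ∈ der (der (der {q})), Qf q' p = 0)
    (h4 : ∀ q' ∈ der (der (der (der {q}))), Qf q' p = 0) :
    LinearMap.trace ℝ E3 (q.2 : E3 →ₗ[ℝ] E3) = 0 := by
  have ho : Orthonormal ℝ (Set.domRestrict ({0} : Set (Fin 3)) (![p, 0, 0] : Fin 3 → E3)) := by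
    constructor
    · rintro ⟨i, hi⟩
      rcases hi with rfl
      exact np
    · rintro ⟨i, hi⟩ ⟨j, hj⟩ hij
      rcases hi with rfl
      rcases hj with rfl
      exact absurd rfl hij
  obtain ⟨e, he⟩ := Orthonormal.exists_orthonormalBasis_extension_of_card_eq (by simp) ho
  have e0 : e 0 = p := by simpa using he 0 (by simp)
  have one : ∀ i, ⟪e i, e i⟫ = (1 : ℝ) := fun i => by
    rw [real_inner_self_eq_norm_sq, e.orthonormal.1 i]; norm_num
  have key : ∀ i, i ≠ 0 → ⟪p, q.2 p⟫ = (0 : ℝ) ∧ ⟪e i, q.2 (e i)⟫ = (0 : ℝ) := by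
    intro i hi
    have sk := Jpu_skew p (e i)
    have m1 : Rr (Jpu p (e i)) q ∈ der {q} := ⟨q, rfl, _, sk, rfl⟩
    have m2 : Rr (Jpu p (e i)) (Rr (Jpu p (e i)) q) ∈ der (der {q}) := ⟨_, m1, _, sk, rfl⟩
    have m3 : Rr (Jpu p (e i)) (Rr (Jpu p (e i)) (Rr (Jpu p (e i)) q)) ∈ der (der (der {q})) :=
      ⟨_, m2, _, sk, rfl⟩
    refine jet p (e i) (by rw [← e0]; exact one 0) (one i)
      (by rw [← e0]; exact e.orthonormal.2 hi.symm) q h0 (h1 _ m1) (h2 _ m2) (h3 _ m3)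
      (h4 _ ⟨_, m3, _, sk, rfl⟩)
  rw [LinearMap.trace_eq_sum_inner _ e, Fin.sum_univ_three, e0]
  have k1 := key 1 (by decide)
  have k2 := key 2 (by decide)
  simp only [ContinuousLinearMap.coe_coe]
  rw [k1.1, k1.2, k2.2]; norm_num

noncomputable def feat (x : E3) : Fin 3 ⊕ (Fin 3 × Fin 3) → ℝ :=
  Sum.elim (fun i => x i) (fun ij => x ij.1 * x ij.2)

noncomputable def e0v : Fin 3 ⊕ (Fin 3 × Fin 3) → ℝ :=
  Sum.elim (fun _ => 0) (fun ij => if ij.1 = ij.2 then 1 / 3 else 0)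

lemma inner3 (x y : E3) : ⟪x, y⟫ = x 0 * y 0 + x 1 * y 1 + x 2 * y 2 := by
  simp [PiLp.inner_apply, Fin.sum_univ_three, mul_comm]

lemma e0v_notMem (τ : ℝ) (hτ0 : 0 < τ) (hτ : 3 < τ ^ 2) (ρ : Measure E3) (hm : IsMinimizer τ ρ)
    (A : Set E3) (hA : A ⊆ msupport ρ) (hd : ∀ x ∈ A, ∀ y ∈ A, ‖x - y‖ ≤ 2 / τ) :
    e0v ∉ Submodule.span ℝ (feat '' A) := by
  intro hmem
  have hsub := msupport_sub ρ hm.2.2.1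
  obtain ⟨n, c, g, hsum⟩ := Submodule.mem_span_set'.1 hmem
  choose x hxA hx using fun i => (g i).2
  have hp := psd τ ρ hm (Fin n) x (fun i => hA (hxA i)) c
  have nx : ∀ i, ‖x i‖ = 1 := fun i => norm_of_sphere (hsub (hA (hxA i)))
  have hs : ∀ k, ∑ i, c i * feat (x i) k = e0v k := by
    intro k
    rw [← hsum, Finset.sum_apply]
    refine Finset.sum_congr rfl fun i _ => ?_
    rw [Pi.smul_apply, smul_eq_mul, hx]
  have h1 : ∀ a : Fin 3, ∑ i, c i * x i a = 0 := fun a => by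
    have := hs (Sum.inl a); simpa [feat, e0v] using this
  have h2 : ∀ a b : Fin 3, ∑ i, c i * (x i a * x i b) = if a = b then 1 / 3 else 0 := fun a b => by
    have := hs (Sum.inr (a, b)); simpa [feat, e0v] using this
  have h0 : ∑ i, c i = 1 := by
    have : ∀ i, c i = c i * (x i 0 * x i 0) + c i * (x i 1 * x i 1) + c i * (x i 2 * x i 2) := by
      intro i
      have := inner3 (x i) (x i)
      rw [real_inner_self_eq_norm_sq, nx i] at this
      rw [← mul_add, ← mul_add, ← this]; ring
    rw [Finset.sum_congr rfl fun i _ => this i, Finset.sum_add_distrib, Finset.sum_add_distrib,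
      h2, h2, h2]
    norm_num
  have key : ∑ i, ∑ j, c i * c j * Lfun τ (x i) (x j) =
      (1 / 4) * ((2 - τ ^ 2) * (∑ i, c i) ^ 2 + 2 * ∑ a, (∑ i, c i * x i a) ^ 2
        + τ ^ 2 * ∑ a, ∑ b, (∑ i, c i * (x i a * x i b)) ^ 2) := by
    have sqs : ∀ f : Fin n → ℝ, (∑ i, f i) ^ 2 = ∑ i, ∑ j, f i * f j := fun f => by
      rw [sq, Finset.sum_mul_sum]
    simp only [sqs, Fin.sum_univ_three, ← Finset.sum_add_distrib, Finset.mul_sum]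
    refine Finset.sum_congr rfl fun i _ => Finset.sum_congr rfl fun j _ => ?_
    rw [Lfun_eq_D_of_near hτ0 (nx i) (nx j) (hd _ (hxA i) _ (hxA j)), Dfun, inner3]
    ring
  rw [key, h0] at hp
  simp only [h1, h2] at hp
  simp [Fin.sum_univ_three] at hp
  nlinarith

lemma local_poly (τ : ℝ) (hτ0 : 0 < τ) (hτ : 3 < τ ^ 2) (ρ : Measure E3) (hm : IsMinimizer τ ρ)
    (A : Set E3) (hA : A ⊆ msupport ρ) (hd : ∀ x ∈ A, ∀ y ∈ A, ‖x - y‖ ≤ 2 / τ) :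
    ∃ q : E3 × (E3 →L[ℝ] E3), LinearMap.trace ℝ E3 (q.2 : E3 →ₗ[ℝ] E3) ≠ 0 ∧
      ∀ x ∈ A, Qf q x = 0 := by
  obtain ⟨ψ, hψ, hker⟩ := Submodule.exists_le_ker_of_notMem (e0v_notMem τ hτ0 hτ ρ hm A hA hd)
  have hrep : ∀ f, ψ f = ∑ k, f k * ψ (Pi.single k 1) := by
    intro f
    rw [LinearMap.pi_apply_eq_sum_univ ψ f]
    refine Finset.sum_congr rfl fun k _ => ?_
    rw [smul_eq_mul]; congr 2; funext j; simp [Pi.single_apply, eq_comm]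
  set m : Matrix (Fin 3) (Fin 3) ℝ := fun i j => ψ (Pi.single (Sum.inr (i, j)) 1)
  have hap : ∀ (x : E3) i, (Matrix.toEuclideanLin m x) i = m i 0 * x 0 + m i 1 * x 1 + m i 2 * x 2 :=
    fun x i => by
      rw [← Fin.sum_univ_three (fun j => m i j * x j)]; rfl
  have hme : ∀ i j, m i j = ψ (Pi.single (Sum.inr (i, j)) 1) := fun i j => rfl
  clear_value m
  refine ⟨(WithLp.toLp 2 fun i => ψ (Pi.single (Sum.inl i) 1),
    LinearMap.toContinuousLinearMap (Matrix.toEuclideanLin m)), ?_, ?_⟩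
  · have : LinearMap.trace ℝ E3 (Matrix.toEuclideanLin m) = 3 * ψ e0v := by
      rw [LinearMap.trace_eq_sum_inner _ (EuclideanSpace.basisFun (Fin 3) ℝ), hrep e0v,
        Fintype.sum_sum_type, Fintype.sum_prod_type]
      simp [e0v, Fin.sum_univ_three, hap, hme, inner3]
      ring
    simpa [this] using hψ
  · intro x hx
    have h1 : ψ (feat x) = 0 := hker (Submodule.subset_span ⟨x, hx, rfl⟩)
    rw [hrep, Fintype.sum_sum_type, Fintype.sum_prod_type] at h1
    rw [← h1]
    simp [Qf, feat, Fin.sum_univ_three, hap, hme, inner3]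
    ring

lemma local_countable (τ : ℝ) (hτ : Real.sqrt 6 < τ) (ρ : Measure E3) (hm : IsMinimizer τ ρ)
    (A : Set E3) (hA : A ⊆ msupport ρ) (hd : ∀ x ∈ A, ∀ y ∈ A, ‖x - y‖ ≤ 2 / τ) :
    A.Countable := by
  have hτ0 : 0 < τ := lt_of_le_of_lt (Real.sqrt_nonneg _) hτ
  have hu : 6 < τ ^ 2 := by
    have := (Real.sqrt_lt (by norm_num) hτ0.le).1 hτ; exact this
  have hsub := msupport_sub ρ hm.2.2.1
  obtain ⟨q, hq, hqA⟩ := local_poly τ hτ0 (by linarith) ρ hm A hA hd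
  refine step τ hτ ρ hm A hA {q} (fun q' hq' => by rw [mem_singleton_iff.1 hq']; exact hqA) ?_
  refine step τ hτ ρ hm _ (fun x hx => hA hx.1) (der {q}) (fun q' hq' x hx => hx.2 q' hq') ?_
  refine step τ hτ ρ hm _ (fun x hx => hA hx.1.1) (der (der {q}))
    (fun q' hq' x hx => hx.2 q' hq') ?_
  refine step τ hτ ρ hm _ (fun x hx => hA hx.1.1.1) (der (der (der {q})))
    (fun q' hq' x hx => hx.2 q' hq') ?_
  refine (Set.countable_empty).mono ?_
  rintro x ⟨⟨⟨⟨hx, h1⟩, h2⟩, h3⟩, h4⟩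
  exact hq (trace_zero x (norm_of_sphere (hsub (hA hx))) q (hqA x hx) h1 h2 h3 h4)

lemma msupport_countable (τ : ℝ) (hτ : Real.sqrt 6 < τ) (ρ : Measure E3) (hm : IsMinimizer τ ρ) :
    (msupport ρ).Countable := by
  have hτ0 : 0 < τ := lt_of_le_of_lt (Real.sqrt_nonneg _) hτ
  let d := TopologicalSpace.denseSeq E3
  refine (Set.countable_iUnion (ι := ℕ) (t := fun n => msupport ρ ∩ Metric.ball (d n) (1 / τ))
    (fun n => local_countable τ hτ ρ hm _ inter_subset_left ?_)).mono ?_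
  · intro x hx y hy
    have h1 := hx.2
    have h2 := hy.2
    rw [Metric.mem_ball] at h1 h2
    rw [← dist_eq_norm]
    have h3 := dist_triangle_right x y (d n)
    have : 2 / τ = 1 / τ + 1 / τ := by ring
    linarith
  · intro x hx
    obtain ⟨m, hm⟩ := (TopologicalSpace.denseRange_denseSeq E3).exists_dist_lt x
      (show (0 : ℝ) < 1 / τ by positivity)
    exact mem_iUnion.2 ⟨m, hx, hm⟩

/-- Theorem 1.2: for `τ > √6`, the support of any minimizing measure is
totally disconnected and has Hausdorff dimension at most `6/7`. -/
theorem stmt_1 (τ : ℝ) (hτ : Real.sqrt 6 < τ) (ρ : Measure E3) (hmin : IsMinimizer τ ρ) :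
    IsTotallyDisconnected (msupport ρ) ∧ dimH (msupport ρ) ≤ 6 / 7 := by
  have hc := msupport_countable τ hτ ρ hmin
  refine ⟨hc.isTotallyDisconnected, ?_⟩
  rw [dimH_countable hc]
  exact zero_le
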